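/- arXiv:2507.22162 — 2 statements merged into one kernel-verified Lean document; each statement's English description precedes it below -/
import Mathlib

section
/- Let L be a Lelek fan. There exists an embedding f : L → L, which is not surjective, such that f admits a retraction from L onto f(L). -/
open Set Topology Filter

section Defs
variable {X : Type*} [TopologicalSpace X]

def IsSubcontinuum (A : Set X) : Prop := IsCompact A ∧ IsConnected A

def IsArc (A : Set X) : Prop := Nonempty (A ≃ₜ (Set.Icc (0:ℝ) 1))

def IsEndpointOfArc (A : Set X) (x : X) : Prop :=
  ∃ φ : (Set.Icc (0:ℝ) 1) ≃ₜ A, ((φ ⟨0, by norm_num⟩ : A) : X) = x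

def IsArcFromTo (A : Set X) (x y : X) : Prop :=
  (x = y ∧ A = {x}) ∨ (x ≠ y ∧ IsArc A ∧ IsEndpointOfArc A x ∧ IsEndpointOfArc A y)

def IsArcwiseConnected (K : Set X) : Prop :=
  ∀ x ∈ K, ∀ y ∈ K, x ≠ y →
    ∃ A, A ⊆ K ∧ IsArc A ∧ IsEndpointOfArc A x ∧ IsEndpointOfArc A y

def IsUnicoherent (K : Set X) : Prop :=
  ∀ A B : Set X, IsSubcontinuum A → IsSubcontinuum B → A ∪ B = K → IsConnected (A ∩ B)

def IsDendroid (K : Set X) : Prop :=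
  IsSubcontinuum K ∧ IsArcwiseConnected K ∧
    ∀ A, A ⊆ K → IsSubcontinuum A → IsUnicoherent A

def triodModel : Set (ℝ × ℝ) := (Set.Icc (-1) 1 ×ˢ ({0} : Set ℝ)) ∪ (({0} : Set ℝ) ×ˢ Set.Icc 0 1)

lemma triod_top_mem : ((0, 0) : ℝ × ℝ) ∈ triodModel := by
  left; exact ⟨by norm_num, rfl⟩

def IsSimpleTriodWithTop (T : Set X) (x : X) : Prop :=
  ∃ φ : triodModel ≃ₜ T, ((φ ⟨(0, 0), triod_top_mem⟩ : T) : X) = x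

def IsRamificationPoint (K : Set X) (x : X) : Prop :=
  x ∈ K ∧ ∃ T, T ⊆ K ∧ IsSimpleTriodWithTop T x

def IsEndpoint (K : Set X) (x : X) : Prop :=
  x ∈ K ∧ ∀ A, A ⊆ K → IsArc A → x ∈ A → IsEndpointOfArc A x

def IsFan (K : Set X) : Prop :=
  IsDendroid K ∧ ∀ x y, IsRamificationPoint K x → IsRamificationPoint K y → x = y

def IsFanWithTop (K : Set X) (v : X) : Prop := IsFan K ∧ IsRamificationPoint K v

def Legs (K : Set X) (v : X) : Set (Set X) :=
  {A | ∃ e, IsEndpoint K e ∧ A ⊆ K ∧ IsArcFromTo A v e}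

def IsRetractOf (B A : Set X) : Prop :=
  ∃ r : X → X, ContinuousOn r A ∧ Set.MapsTo r A B ∧ Set.EqOn r id B

end Defs

section MetricDefs
variable {X : Type*} [MetricSpace X]

def IsSmoothFan (K : Set X) (v : X) : Prop :=
  IsFanWithTop K v ∧
  ∀ x ∈ K, ∀ xs : ℕ → X, (∀ n, xs n ∈ K) → Tendsto xs atTop (nhds x) →
    ∀ A : Set X, A ⊆ K → IsArcFromTo A v x →
    ∀ As : ℕ → Set X, (∀ n, As n ⊆ K ∧ IsArcFromTo (As n) v (xs n)) →
      Tendsto (fun n => Metric.hausdorffDist (As n) A) atTop (nhds 0)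

def IsLelekFan (K : Set X) (v : X) : Prop :=
  IsSmoothFan K v ∧ K ⊆ closure {x | IsEndpoint K x}

def IsWedge (L : Set X) (v : X) (W : Set X) : Prop :=
  W ⊆ L ∧ IsSubcontinuum W ∧ IsLelekFan W v ∧ IsLelekFan ((L \ W) ∪ {v}) v

end MetricDefs

def coneSetoid (Z : Type*) : Setoid (Z × Set.Icc (0:ℝ) 1) where
  r a b := a = b ∨ ((a.2 : ℝ) = 0 ∧ (b.2 : ℝ) = 0)
  iseqv := by
    refine ⟨fun a => Or.inl rfl, ?_, ?_⟩
    · rintro a b (rfl | h)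
      · exact Or.inl rfl
      · exact Or.inr ⟨h.2, h.1⟩
    · rintro a b c (rfl | h) (rfl | h')
      · exact Or.inl rfl
      · exact Or.inr h'
      · exact Or.inr h
      · exact Or.inr ⟨h.1, h'.2⟩

abbrev CantorFanSpace : Type := Quotient (coneSetoid (ℕ → Bool))

def IsCantorFan {X : Type*} [TopologicalSpace X] (K : Set X) (v : X) : Prop :=
  IsFanWithTop K v ∧ Nonempty (K ≃ₜ CantorFanSpace)

def IsConfluent {X Y : Type*} [TopologicalSpace X] [TopologicalSpace Y] (f : X → Y) : Prop :=
  ∀ Q : Set Y, Q ⊆ Set.range f → IsCompact Q → IsConnected Q →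
    ∀ x ∈ f ⁻¹' Q, f '' connectedComponentIn (f ⁻¹' Q) x = Q


section LelekFunctions

/-- A Lelek function: a nonnegative upper semicontinuous function, positive on a dense set, whose
graph is dense in the region between it and `0`. -/
structure IsLelekFunction {C : Type*} [TopologicalSpace C] (φ : C → ℝ) : Prop where
  nonneg : ∀ x, 0 ≤ φ x
  usc : UpperSemicontinuous φ
  exists_pos : ∀ U, IsOpen U → U.Nonempty → ∃ x ∈ U, 0 < φ x
  exists_near : ∀ U, IsOpen U → ∀ x ∈ U, ∀ s, 0 < s → s ≤ φ x → ∀ ε > 0, ∃ y ∈ U, |φ y - s| < ε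

/-- The maximum of `φ` on `U`. -/
noncomputable def peak {C : Type*} (φ : C → ℝ) (U : Set C) : ℝ := sSup (φ '' U)

theorem exists_eq_peak {C : Type*} [TopologicalSpace C] [CompactSpace C] {φ : C → ℝ}
    (hφ : UpperSemicontinuous φ) {U : Set C} (hU : IsClosed U) (hne : U.Nonempty) :
    ∃ x ∈ U, φ x = peak φ U ∧ ∀ y ∈ U, φ y ≤ φ x := by
  obtain ⟨x, hx, hmax⟩ := UpperSemicontinuousOn.exists_isMaxOn hne hU.isCompact
    (hφ.upperSemicontinuousOn U)
  have h : ∀ y ∈ U, φ y ≤ φ x := fun y hy => hmax hy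
  refine ⟨x, hx, ?_, h⟩
  refine (IsGreatest.csSup_eq ⟨mem_image_of_mem _ hx, ?_⟩).symm
  rintro _ ⟨y, hy, rfl⟩
  exact h y hy

theorem le_peak {C : Type*} [TopologicalSpace C] [CompactSpace C] {φ : C → ℝ}
    (hφ : UpperSemicontinuous φ) {U : Set C} (hU : IsClosed U) {y : C} (hy : y ∈ U) :
    φ y ≤ peak φ U := by
  obtain ⟨x, -, h, hm⟩ := exists_eq_peak hφ hU ⟨y, hy⟩
  exact h ▸ hm y hy

theorem peak_le {C : Type*} [TopologicalSpace C] [CompactSpace C] {φ : C → ℝ}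
    (hφ : UpperSemicontinuous φ) {U : Set C} (hU : IsClosed U) (hne : U.Nonempty) {m : ℝ}
    (h : ∀ y ∈ U, φ y ≤ m) : peak φ U ≤ m := by
  obtain ⟨x, hx, e, -⟩ := exists_eq_peak hφ hU hne
  exact e ▸ h x hx

theorem IsLelekFunction.peak_pos {C : Type*} [TopologicalSpace C] [CompactSpace C] {φ : C → ℝ}
    (hφ : IsLelekFunction φ) {U : Set C} (hU : IsClopen U) (hne : U.Nonempty) :
    0 < peak φ U := by
  obtain ⟨x, hx, h⟩ := hφ.exists_pos U hU.isOpen hne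
  exact h.trans_le (le_peak hφ.usc hU.isClosed hx)

theorem IsLelekFunction.exists_clopen_peak {D : Type*} [TopologicalSpace D] [CompactSpace D]
    [T2Space D] [TotallyDisconnectedSpace D] {ψ : D → ℝ} (hψ : IsLelekFunction ψ) {V : Set D}
    (hV : IsClopen V) (hne : V.Nonempty) {m : ℝ} (hm : 0 < m) (hmV : m ≤ peak ψ V) {δ : ℝ}
    (hδ : 0 < δ) :
    ∃ T ⊆ V, IsClopen T ∧ T.Nonempty ∧ (V \ T).Nonempty ∧ peak ψ (V \ T) = peak ψ V ∧
      |Real.log (peak ψ T) - Real.log m| ≤ δ := by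
  obtain ⟨x, hxV, hx, hmax⟩ := exists_eq_peak hψ.usc hV.isClosed hne
  have he : ∀ t : ℝ, 0 < t → m * Real.exp (-t) < m := fun t ht =>
    mul_lt_of_lt_one_right hm (by simpa using ht)
  have h1 : m * Real.exp (-δ) < m * Real.exp (-(δ / 2)) := by
    gcongr; linarith
  have h2 := he (δ / 2) (by linarith)
  obtain ⟨y, hyV, hy⟩ := hψ.exists_near V hV.isOpen x hxV (m * Real.exp (-(δ / 2)))
    (by positivity) (by rw [hx]; linarith)
    (min (m - m * Real.exp (-(δ / 2))) (m * Real.exp (-(δ / 2)) - m * Real.exp (-δ)))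
    (lt_min (by linarith) (by linarith))
  obtain ⟨hy1, hy2⟩ := lt_min_iff.1 hy
  rw [abs_lt] at hy1 hy2
  obtain ⟨T, hT, hyT, hTU⟩ := compact_exists_isClopen_in_isOpen
    (hV.isOpen.inter (hψ.usc.isOpen_preimage m)) (x := y) ⟨hyV, by simp; linarith⟩
  have hxT : x ∉ T := fun h => by
    have := (hTU h).2
    simp only [mem_preimage, mem_Iio] at this
    linarith
  refine ⟨T, fun z hz => (hTU hz).1, hT, ⟨y, hyT⟩, ⟨x, hxV, hxT⟩, ?_, ?_⟩
  · have hc := (hV.diff hT).isClosed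
    apply le_antisymm
    · exact peak_le hψ.usc hc ⟨x, hxV, hxT⟩ fun z hz => le_peak hψ.usc hV.isClosed hz.1
    · rw [← hx]
      exact le_peak hψ.usc hc ⟨hxV, hxT⟩
  · have hle : peak ψ T ≤ m := peak_le hψ.usc hT.isClosed ⟨y, hyT⟩ fun z hz =>
      (show ψ z < m from (hTU hz).2).le
    have hge : m * Real.exp (-δ) ≤ peak ψ T :=
      le_trans (by linarith) (le_peak hψ.usc hT.isClosed hyT)
    have hp : 0 < peak ψ T := lt_of_lt_of_le (by positivity) hge
    have l1 := Real.log_le_log hp hle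
    have l2 := Real.log_le_log (by positivity) hge
    rw [Real.log_mul hm.ne' (Real.exp_pos _).ne', Real.log_exp] at l2
    rw [abs_le]
    constructor <;> linarith

/-- `logRatio φ ψ U V` compares the maximum of `ψ` on `V` with that of `φ` on `U`. -/
noncomputable def logRatio {C D : Type*} (φ : C → ℝ) (ψ : D → ℝ) (U : Set C) (V : Set D) : ℝ :=
  Real.log (peak ψ V) - Real.log (peak φ U)

section Matching

variable {C D : Type*} [TopologicalSpace C] [CompactSpace C] [TopologicalSpace D] [CompactSpace D]
  {φ : C → ℝ} {ψ : D → ℝ}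

/-- `S` is a part of `U` matched by a part `T` of `V`, with logarithmic distortion at most `δ`. -/
def PartMatches (φ : C → ℝ) (ψ : D → ℝ) (δ : ℝ) (U : Set C) (V : Set D) (S : Set C)
    (T : Set D) : Prop :=
  (S.Nonempty ↔ T.Nonempty) ∧ (S.Nonempty → |logRatio φ ψ S T - logRatio φ ψ U V| ≤ δ)

omit [TopologicalSpace C] [CompactSpace C] [TopologicalSpace D] [CompactSpace D] in
theorem partMatches_of_not_nonempty {δ : ℝ} {U U' : Set C} {V V' : Set D} (h : ¬ U'.Nonempty)
    (h' : ¬ V'.Nonempty) : PartMatches φ ψ δ U V U' V' :=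
  ⟨by simp [h, h'], fun h'' => absurd h'' h⟩

theorem exists_matching_of_peak_eq [T2Space D] [TotallyDisconnectedSpace D]
    (hφ : IsLelekFunction φ) (hψ : IsLelekFunction ψ) {U U' : Set C} {V : Set D} (hU' : IsClopen U')
    (hV : IsClopen V) (hVne : V.Nonempty) (hUcl : IsClopen U) (hU'U : U' ⊆ U)
    (hne' : U'.Nonempty) (hpeak : peak φ (U \ U') = peak φ U) {δ : ℝ} (hδ : 0 < δ)
    (hne : (U \ U').Nonempty) :
    ∃ T ⊆ V, IsClopen T ∧ PartMatches φ ψ δ U V U' T ∧ PartMatches φ ψ δ U V (U \ U') (V \ T) := by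
  have p1 := hφ.peak_pos hU' hne'
  have p2 := hφ.peak_pos hUcl (hne'.mono hU'U)
  have p3 := hψ.peak_pos hV hVne
  have hle : peak φ U' ≤ peak φ U := peak_le hφ.usc hU'.isClosed hne' fun z hz =>
    le_peak hφ.usc hUcl.isClosed (hU'U hz)
  obtain ⟨T, hTV, hT, hTne, hVT, hpT, hlog⟩ := hψ.exists_clopen_peak hV hVne
    (m := peak φ U' * peak ψ V / peak φ U) (by positivity)
    (by rw [div_le_iff₀ p2]; nlinarith) hδ
  refine ⟨T, hTV, hT, ⟨by simp [hne', hTne], fun _ => ?_⟩, ⟨by simp [hne, hVT], fun _ => ?_⟩⟩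
  · rw [Real.log_div (by positivity) p2.ne', Real.log_mul p1.ne' p3.ne'] at hlog
    unfold logRatio
    convert hlog using 2
    ring
  · unfold logRatio
    rw [hpT, hpeak]
    simpa using hδ.le

theorem exists_matching [T2Space D] [TotallyDisconnectedSpace D]
    (hφ : IsLelekFunction φ) (hψ : IsLelekFunction ψ) {U B : Set C} {V : Set D} (hB : IsClopen B)
    (hU : IsClopen U) (hV : IsClopen V) (hUV : U.Nonempty ↔ V.Nonempty) {δ : ℝ} (hδ : 0 < δ) :
    ∃ T ⊆ V, IsClopen T ∧ PartMatches φ ψ δ U V (U ∩ B) T ∧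
      PartMatches φ ψ δ U V (U \ B) (V \ T) := by
  by_cases h1 : (U ∩ B).Nonempty
  · have hUne : U.Nonempty := h1.mono inter_subset_left
    have hVne := hUV.1 hUne
    by_cases h2 : (U \ B).Nonempty
    · have e1 : U \ (U ∩ B) = U \ B := by ext; simp
      have e2 : U \ (U \ B) = U ∩ B := by ext; simp
      obtain ⟨x, hxU, hx, hmax⟩ := exists_eq_peak hφ.usc hU.isClosed hUne
      have key : ∀ W : Set C, IsClopen W → W ⊆ U → x ∈ W → peak φ W = peak φ U := by
        intro W hW hWU hxW
        apply le_antisymm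
        · exact peak_le hφ.usc hW.isClosed ⟨x, hxW⟩ fun z hz => hx ▸ hmax z (hWU hz)
        · exact hx ▸ le_peak hφ.usc hW.isClosed hxW
      by_cases hxB : x ∈ B
      · obtain ⟨T, hTV, hT, m1, m2⟩ := exists_matching_of_peak_eq hφ hψ (hU.diff hB) hV hVne hU
          sdiff_subset h2 (by rw [e2]; exact key _ (hU.inter hB) inter_subset_left ⟨hxU, hxB⟩)
          hδ (by rwa [e2])
        rw [e2] at m2
        refine ⟨V \ T, sdiff_subset, hV.diff hT, m2, ?_⟩
        rwa [sdiff_sdiff_eq_self hTV]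
      · obtain ⟨T, hTV, hT, m1, m2⟩ := exists_matching_of_peak_eq hφ hψ (hU.inter hB) hV hVne hU
          inter_subset_left h1 (by rw [e1]; exact key _ (hU.diff hB) sdiff_subset ⟨hxU, hxB⟩)
          hδ (by rwa [e1])
        rw [e1] at m2
        exact ⟨T, hTV, hT, m1, m2⟩
    · have e : U ∩ B = U := by
        rw [inter_eq_left]
        exact sdiff_eq_empty.1 (not_nonempty_iff_eq_empty.1 h2)
      refine ⟨V, Subset.rfl, hV, ⟨by rw [e]; exact hUV, fun _ => by rw [e]; simpa using hδ.le⟩,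
        partMatches_of_not_nonempty h2 (by simp)⟩
  · have e : U \ B = U := by
      rw [sdiff_eq_left, disjoint_iff_inter_eq_empty]
      exact not_nonempty_iff_eq_empty.1 h1
    refine ⟨∅, empty_subset _, isClopen_empty, partMatches_of_not_nonempty h1 (by simp), ?_⟩
    rw [e, sdiff_empty]
    exact ⟨hUV, fun _ => by simpa using hδ.le⟩

/-- A pair of finite clopen partitions, given as fibres of continuous maps, with the same
labels. -/
structure IsMatchedPair (p : C → ℕ) (q : D → ℕ) : Prop where
  continuous_left : Continuous p
  continuous_right : Continuous q
  range_eq : range p = range q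

omit [CompactSpace C] [CompactSpace D] in
theorem IsMatchedPair.symm {p : C → ℕ} {q : D → ℕ} (h : IsMatchedPair p q) : IsMatchedPair q p :=
  ⟨h.continuous_right, h.continuous_left, h.range_eq.symm⟩

theorem logRatio_symm {C D : Type*} (φ : C → ℝ) (ψ : D → ℝ) (U : Set C) (V : Set D) :
    logRatio ψ φ V U = -logRatio φ ψ U V := by
  simp [logRatio]

open Classical in
/-- The partition of labels `p` cut along the set `B`. -/
noncomputable def cut {C : Type*} (p : C → ℕ) (B : Set C) (x : C) : ℕ :=
  if x ∈ B then 2 * p x + 1 else 2 * p x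

theorem cut_div_two {C : Type*} (p : C → ℕ) (B : Set C) (x : C) : cut p B x / 2 = p x := by
  unfold cut; split_ifs <;> omega

theorem cut_cut_div_four {C : Type*} (p : C → ℕ) (B B' : Set C) (x : C) :
    cut (cut p B) B' x / 4 = p x := by
  rw [show (4 : ℕ) = 2 * 2 from rfl, ← Nat.div_div_eq_div_mul, cut_div_two, cut_div_two]

theorem cut_preimage_odd {C : Type*} (p : C → ℕ) (B : Set C) (i : ℕ) :
    cut p B ⁻¹' {2 * i + 1} = p ⁻¹' {i} ∩ B := by
  ext x; simp only [cut, mem_preimage, mem_singleton_iff, mem_inter_iff]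
  split_ifs with h <;> simp [h]
  omega

theorem cut_preimage_even {C : Type*} (p : C → ℕ) (B : Set C) (i : ℕ) :
    cut p B ⁻¹' {2 * i} = p ⁻¹' {i} \ B := by
  ext x; simp only [cut, mem_preimage, mem_singleton_iff, Set.mem_sdiff]
  split_ifs with h <;> simp [h]
  omega

theorem cut_eq_imp {C : Type*} {p : C → ℕ} {B : Set C} {x y : C} (h : cut p B x = cut p B y) :
    x ∈ B ↔ y ∈ B := by
  unfold cut at h; split_ifs at h with h1 h2 h2 <;> simp [h1, h2] <;> omega

theorem continuous_cut {C : Type*} [TopologicalSpace C] {p : C → ℕ} (hp : Continuous p) {B : Set C}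
    (hB : IsClopen B) : Continuous (cut p B) := by
  classical
  refine Continuous.if ?_ ((continuous_of_discreteTopology (f := fun n => 2 * n + 1)).comp hp)
    ((continuous_of_discreteTopology (f := fun n => 2 * n)).comp hp)
  intro a ha
  rw [ofPred_mem_eq, hB.frontier_eq] at ha
  exact ha.elim

theorem IsMatchedPair.exists_cut [T2Space D] [TotallyDisconnectedSpace D]
    (hφ : IsLelekFunction φ) (hψ : IsLelekFunction ψ) {p : C → ℕ} {q : D → ℕ}
    (h : IsMatchedPair p q) {B : Set C} (hB : IsClopen B) {δ : ℝ} (hδ : 0 < δ) :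
    ∃ T : Set D, IsMatchedPair (cut p B) (cut q T) ∧ ∀ i ∈ range (cut p B),
      |logRatio φ ψ (cut p B ⁻¹' {i}) (cut q T ⁻¹' {i}) -
        logRatio φ ψ (p ⁻¹' {i / 2}) (q ⁻¹' {i / 2})| ≤ δ := by
  have cp : ∀ i, IsClopen (p ⁻¹' {i}) := fun i => (isClopen_discrete _).preimage h.continuous_left
  have cq : ∀ i, IsClopen (q ⁻¹' {i}) := fun i => (isClopen_discrete _).preimage h.continuous_right
  have hne : ∀ i, (p ⁻¹' {i}).Nonempty ↔ (q ⁻¹' {i}).Nonempty := fun i => by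
    have : i ∈ range p ↔ i ∈ range q := by rw [h.range_eq]
    exact this
  choose T hTV hT hm1 hm2 using fun i => exists_matching hφ hψ hB (cp i) (cq i) (hne i) hδ
  have hTi : ∀ i, q ⁻¹' {i} ∩ ⋃ j, T j = T i := by
    intro i
    ext y
    simp only [mem_inter_iff, mem_preimage, mem_singleton_iff, mem_iUnion]
    refine ⟨?_, fun hy => ⟨hTV i hy, i, hy⟩⟩
    rintro ⟨rfl, j, hj⟩
    have : q y = j := hTV j hj
    rwa [this]
  have hTd : ∀ i, q ⁻¹' {i} \ ⋃ j, T j = q ⁻¹' {i} \ T i := by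
    intro i
    rw [← hTi i, sdiff_self_inter]
  have hcl : IsClopen (⋃ j, T j) := by
    refine ⟨?_, isOpen_iUnion fun j => (hT j).isOpen⟩
    have : (⋃ j, T j)ᶜ = ⋃ i, q ⁻¹' {i} \ T i := by
      ext y
      simp [← hTd]
    rw [← isOpen_compl_iff, this]
    exact isOpen_iUnion fun i => ((cq i).diff (hT i)).isOpen
  have hmatch : ∀ i, PartMatches φ ψ δ (p ⁻¹' {i / 2}) (q ⁻¹' {i / 2}) (cut p B ⁻¹' {i})
      (cut q (⋃ j, T j) ⁻¹' {i}) := by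
    intro i
    obtain ⟨k, rfl | rfl⟩ := Nat.even_or_odd' i
    · rw [cut_preimage_even, cut_preimage_even, hTd, Nat.mul_div_cancel_left _ two_pos]
      exact hm2 k
    · rw [cut_preimage_odd, cut_preimage_odd, hTi, show (2 * k + 1) / 2 = k by omega]
      exact hm1 k
  refine ⟨⋃ j, T j, ⟨continuous_cut h.continuous_left hB, continuous_cut h.continuous_right hcl,
    ?_⟩, fun i hi => (hmatch i).2 hi⟩
  ext i
  exact (hmatch i).1

/-- `(r, s)` refines `(p, q)`, with distortion at most `δ`, and decides `B` and `E`. -/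
structure Refines (φ : C → ℝ) (ψ : D → ℝ) (p : C → ℕ) (q : D → ℕ) (B : Set C) (E : Set D) (δ : ℝ)
    (r : C → ℕ) (s : D → ℕ) : Prop where
  left : ∀ x, r x / 4 = p x
  right : ∀ y, s y / 4 = q y
  decides_left : ∀ x z, r x = r z → (x ∈ B ↔ z ∈ B)
  decides_right : ∀ y z, s y = s z → (y ∈ E ↔ z ∈ E)
  distortion : ∀ i ∈ range r, |logRatio φ ψ (r ⁻¹' {i}) (s ⁻¹' {i}) -
    logRatio φ ψ (p ⁻¹' {i / 4}) (q ⁻¹' {i / 4})| ≤ δ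

theorem IsMatchedPair.exists_refines [T2Space C] [TotallyDisconnectedSpace C]
    [T2Space D] [TotallyDisconnectedSpace D]
    (hφ : IsLelekFunction φ) (hψ : IsLelekFunction ψ) {p : C → ℕ} {q : D → ℕ}
    (h : IsMatchedPair p q) {B : Set C} (hB : IsClopen B) {B' : Set D} (hB' : IsClopen B')
    {δ : ℝ} (hδ : 0 < δ) :
    ∃ p' q', IsMatchedPair p' q' ∧ Refines φ ψ p q B B' δ p' q' := by
  obtain ⟨T, h1, d1⟩ := h.exists_cut hφ hψ hB (half_pos hδ)
  obtain ⟨T', h2, d2⟩ := h1.symm.exists_cut hψ hφ hB' (half_pos hδ)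
  refine ⟨_, _, h2.symm, cut_cut_div_four _ _ _, cut_cut_div_four _ _ _, ?_,
    fun y y' hy => cut_eq_imp hy, ?_⟩
  · intro x x' hx
    apply cut_eq_imp (p := p)
    rw [← cut_div_two (cut p B) T' x, hx, cut_div_two]
  · intro i hi
    have e2 := d2 i (h2.range_eq ▸ hi)
    have e1 := d1 (i / 2) (by
      obtain ⟨x, rfl⟩ := hi
      exact ⟨x, (cut_div_two _ _ x).symm⟩)
    rw [logRatio_symm φ ψ, logRatio_symm φ ψ, neg_sub_neg, abs_sub_comm] at e2
    rw [Nat.div_div_eq_div_mul] at e1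
    calc _ ≤ _ := abs_sub_le _ _ _
      _ ≤ δ / 2 + δ / 2 := add_le_add e2 e1
      _ = δ := add_halves δ

theorem exists_refining_sequence [T2Space C] [TotallyDisconnectedSpace C]
    [T2Space D] [TotallyDisconnectedSpace D] [Nonempty C] [Nonempty D]
    (hφ : IsLelekFunction φ) (hψ : IsLelekFunction ψ) {B : ℕ → Set C} (hB : ∀ n, IsClopen (B n))
    {B' : ℕ → Set D} (hB' : ∀ n, IsClopen (B' n)) {δ : ℕ → ℝ} (hδ : ∀ n, 0 < δ n) :
    ∃ (p : ℕ → C → ℕ) (q : ℕ → D → ℕ), (∀ n, IsMatchedPair (p n) (q n)) ∧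
      ∀ n, Refines φ ψ (p n) (q n) (B n) (B' n) (δ n) (p (n + 1)) (q (n + 1)) := by
  have step : ∀ n (s : {s : (C → ℕ) × (D → ℕ) // IsMatchedPair s.1 s.2}),
      ∃ s' : {s : (C → ℕ) × (D → ℕ) // IsMatchedPair s.1 s.2},
        Refines φ ψ s.1.1 s.1.2 (B n) (B' n) (δ n) s'.1.1 s'.1.2 := by
    intro n s
    obtain ⟨p', q', h, h'⟩ := s.2.exists_refines hφ hψ (hB n) (hB' n) (hδ n)
    exact ⟨⟨(p', q'), h⟩, h'⟩
  choose next hnext using step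
  let s : ℕ → {s : (C → ℕ) × (D → ℕ) // IsMatchedPair s.1 s.2} := fun n =>
    Nat.rec ⟨(fun _ => 0, fun _ => 0), continuous_const, continuous_const, by simp⟩
      (fun n t => next n t) n
  exact ⟨fun n => (s n).1.1, fun n => (s n).1.2, fun n => (s n).2, fun n => hnext n (s n)⟩

end Matching

section Limit

variable {C D : Type*} [TopologicalSpace C] [CompactSpace C] [TopologicalSpace D] [CompactSpace D]

omit [CompactSpace C] in
theorem exists_forall_label_eq {p : ℕ → C → ℕ} {q : ℕ → D → ℕ}
    (h : ∀ n, IsMatchedPair (p n) (q n)) (hp : ∀ n x, p (n + 1) x / 4 = p n x)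
    (hq : ∀ n y, q (n + 1) y / 4 = q n y) (x : C) : ∃ y, ∀ n, q n y = p n x := by
  have hcl : ∀ n, IsClosed (q n ⁻¹' {p n x}) := fun n =>
    (isClosed_discrete _).preimage (h n).continuous_right
  obtain ⟨y, hy⟩ := IsCompact.nonempty_iInter_of_sequence_nonempty_isCompact_isClosed
    (fun n => q n ⁻¹' {p n x})
    (fun n y hy => by
      simp only [mem_preimage, mem_singleton_iff] at hy ⊢
      rw [← hq, hy, hp])
    (fun n => by
      obtain ⟨y, hy⟩ : p n x ∈ range (q n) := (h n).range_eq ▸ mem_range_self x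
      exact ⟨y, hy⟩)
    (hcl 0).isCompact hcl
  exact ⟨y, fun n => mem_iInter.1 hy n⟩

theorem tendsto_peak {φ : C → ℝ} (hφ : UpperSemicontinuous φ) {p : ℕ → C → ℕ}
    (hc : ∀ n, Continuous (p n)) (hp : ∀ n x, p (n + 1) x / 4 = p n x)
    (hinj : ∀ x y, (∀ n, p n x = p n y) → x = y) (x : C) :
    Tendsto (fun n => peak φ (p n ⁻¹' {p n x})) atTop (𝓝 (φ x)) := by
  have hcl : ∀ n, IsClosed (p n ⁻¹' {p n x}) := fun n => (isClosed_discrete _).preimage (hc n)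
  have hanti : Antitone fun n => p n ⁻¹' {p n x} := antitone_nat_of_succ_le fun n y hy => by
    simp only [mem_preimage, mem_singleton_iff] at hy ⊢
    rw [← hp, hy, hp]
  have hlow : ∀ n, φ x ≤ peak φ (p n ⁻¹' {p n x}) := fun n => le_peak hφ (hcl n) rfl
  rw [Metric.tendsto_atTop]
  intro ε hε
  obtain ⟨N, hN⟩ := exists_subset_nhds_of_compactSpace hanti.directed_ge hcl
    (U := φ ⁻¹' Iio (φ x + ε / 2)) (fun y hy => by
      have : y = x := hinj y x fun n => mem_iInter.1 hy n
      subst this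
      exact (hφ.isOpen_preimage _).mem_nhds (by simp [hε]))
  refine ⟨N, fun n hn => ?_⟩
  have hup : peak φ (p n ⁻¹' {p n x}) ≤ φ x + ε / 2 :=
    peak_le hφ (hcl n) ⟨x, rfl⟩ fun y hy => (show φ y < _ from hN (hanti hn hy)).le
  rw [Real.dist_eq, abs_lt]
  constructor <;> linarith [hlow n]

omit [CompactSpace C] in
theorem exists_continuous_limit {a : ℕ → C → ℝ} (hc : ∀ n, Continuous (a n))
    (h : ∀ n x, |a (n + 1) x - a n x| ≤ (1 / 2) ^ n) :
    ∃ b : C → ℝ, Continuous b ∧ ∀ x, Tendsto (fun n => a n x) atTop (𝓝 (b x)) := by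
  have hs : Summable fun n : ℕ => (1 / 2 : ℝ) ^ n := summable_geometric_two
  refine ⟨fun x => ∑' n, (a (n + 1) x - a n x) + a 0 x,
    (continuous_tsum (fun n => (hc (n + 1)).sub (hc n)) hs h).add (hc 0), fun x => ?_⟩
  have := (Summable.of_norm_bounded (f := fun n => a (n + 1) x - a n x) hs
    fun n => h n x).hasSum.tendsto_sum_nat
  simp only [Finset.sum_range_sub (fun n => a n x)] at this
  simpa using this.add_const (a 0 x)

/-- Any two Lelek functions on compact zero-dimensional spaces agree up to a homeomorphism of the
spaces and a continuous positive factor. -/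
theorem IsLelekFunction.exists_homeomorph [T2Space C] [TotallyDisconnectedSpace C]
    [T2Space D] [TotallyDisconnectedSpace D] [Nonempty C] [Nonempty D] {φ : C → ℝ} {ψ : D → ℝ}
    (hφ : IsLelekFunction φ) (hψ : IsLelekFunction ψ) {B : ℕ → Set C} (hB : ∀ n, IsClopen (B n))
    (hBsep : ∀ x y, (∀ n, x ∈ B n ↔ y ∈ B n) → x = y)
    {B' : ℕ → Set D} (hB' : ∀ n, IsClopen (B' n))
    (hBsep' : ∀ x y, (∀ n, x ∈ B' n ↔ y ∈ B' n) → x = y) :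
    ∃ (β : C ≃ₜ D) (a : C → ℝ), Continuous a ∧ ∀ x, ψ (β x) = Real.exp (a x) * φ x := by
  obtain ⟨p, q, hpq, href⟩ := exists_refining_sequence hφ hψ hB hB' (δ := fun n => (1 / 2) ^ n)
    (fun n => by positivity)
  have hp n := (href n).left
  have hq n := (href n).right
  have hpinj : ∀ x y, (∀ n, p n x = p n y) → x = y := fun x y h =>
    hBsep x y fun n => (href n).decides_left x y (h (n + 1))
  have hqinj : ∀ x y, (∀ n, q n x = q n y) → x = y := fun x y h =>
    hBsep' x y fun n => (href n).decides_right x y (h (n + 1))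
  choose β hβ using exists_forall_label_eq hpq hp hq
  choose γ hγ using exists_forall_label_eq (fun n => (hpq n).symm) hq hp
  let e : C ≃ D := ⟨β, γ, fun x => hpinj _ _ fun n => by rw [hγ, hβ],
    fun y => hqinj _ _ fun n => by rw [hβ, hγ]⟩
  have hQ : Continuous fun y n => q n y := continuous_pi fun n => (hpq n).continuous_right
  have hQe : IsClosedEmbedding fun y n => q n y :=
    hQ.isClosedEmbedding fun x y h => hqinj x y fun n => congrFun h n
  have hcont : Continuous e := by
    rw [hQe.isInducing.continuous_iff]
    refine continuous_pi fun n => ?_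
    convert (hpq n).continuous_left using 1
    ext x
    exact hβ x n
  obtain ⟨a, ha, hlim⟩ := exists_continuous_limit (C := C)
    (a := fun n x => logRatio φ ψ (p n ⁻¹' {p n x}) (q n ⁻¹' {p n x}))
    (fun n => (continuous_of_discreteTopology
      (f := fun i => logRatio φ ψ (p n ⁻¹' {i}) (q n ⁻¹' {i}))).comp (hpq n).continuous_left)
    (fun n x => by
      have := (href n).distortion (p (n + 1) x) (mem_range_self x)
      rwa [hp] at this)
  refine ⟨hcont.homeoOfEquivCompactToT2, a, ha, fun x => ?_⟩
  have t1 := tendsto_peak hφ.usc (fun n => (hpq n).continuous_left) hp hpinj x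
  have t2 := tendsto_peak hψ.usc (fun n => (hpq n).continuous_right) hq hqinj (β x)
  refine tendsto_nhds_unique t2 ((((Real.continuous_exp.tendsto _).comp (hlim x)).mul t1).congr
    fun n => ?_)
  have hC := hφ.peak_pos ((isClopen_discrete {p n x}).preimage (hpq n).continuous_left) ⟨x, rfl⟩
  have hD := hψ.peak_pos ((isClopen_discrete {p n x}).preimage (hpq n).continuous_right)
    ⟨β x, hβ x n⟩
  simp only [Function.comp_apply, hβ, logRatio]
  rw [Real.exp_sub, Real.exp_log hC, Real.exp_log hD, div_mul_cancel₀ _ hC.ne']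

end Limit

end LelekFunctions

section Coordinates

/-- Coordinates on a fan with top `v`: a height `ρ` and a map `κ`, defined away from `v`, that
tells the legs apart. -/
structure IsFanCoordinates {L C : Type*} [TopologicalSpace L] [TopologicalSpace C] (v : L)
    (ρ : L → ℝ) (κ : L → C) : Prop where
  continuous_height : Continuous ρ
  height_nonneg : ∀ x, 0 ≤ ρ x
  height_eq_zero : ∀ x, ρ x = 0 ↔ x = v
  continuousAt_leg : ∀ x, x ≠ v → ContinuousAt κ x
  dense_legs : Dense (κ '' {v}ᶜ)
  injective : ∀ x y, x ≠ v → y ≠ v → κ x = κ y → ρ x = ρ y → x = y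
  exists_lower : ∀ x, x ≠ v → ∀ s, 0 < s → s ≤ ρ x → ∃ y, y ≠ v ∧ κ y = κ x ∧ ρ y = s
  exists_endpoint : ∀ x, x ≠ v → ∀ U ∈ 𝓝 x,
    ∃ e ∈ U, e ≠ v ∧ ∀ y, y ≠ v → κ y = κ e → ρ y ≤ ρ e

/-- The height of the leg labelled by `c`. -/
noncomputable def legHeight {L C : Type*} (v : L) (ρ : L → ℝ) (κ : L → C) (c : C) : ℝ :=
  sSup (insert 0 (ρ '' {x | x ≠ v ∧ κ x = c}))

namespace IsFanCoordinates

variable {L C : Type*} [TopologicalSpace L] [CompactSpace L] [TopologicalSpace C] [T2Space C]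
  {v : L} {ρ : L → ℝ} {κ : L → C}

omit [CompactSpace L] [T2Space C] in
theorem height_pos (h : IsFanCoordinates v ρ κ) {x : L} (hx : x ≠ v) : 0 < ρ x :=
  (h.height_nonneg x).lt_of_ne fun e => hx ((h.height_eq_zero x).1 e.symm)

omit [CompactSpace L] [T2Space C] in
theorem ne_of_height_pos (h : IsFanCoordinates v ρ κ) {x : L} (hx : 0 < ρ x) : x ≠ v :=
  fun e => hx.ne' ((h.height_eq_zero x).2 e)

omit [CompactSpace L] [T2Space C] in
theorem continuousOn_leg (h : IsFanCoordinates v ρ κ) {t : ℝ} (ht : 0 < t) :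
    ContinuousOn κ {x | t ≤ ρ x} := fun x hx =>
  (h.continuousAt_leg x (h.ne_of_height_pos (ht.trans_le hx))).continuousWithinAt

omit [CompactSpace L] [T2Space C] in
theorem isClosed_le_height (h : IsFanCoordinates v ρ κ) (t : ℝ) : IsClosed {x | t ≤ ρ x} :=
  isClosed_le continuous_const h.continuous_height

omit [T2Space C] in
theorem bddAbove (h : IsFanCoordinates v ρ κ) (c : C) :
    BddAbove (insert 0 (ρ '' {x | x ≠ v ∧ κ x = c})) :=
  ((isCompact_range h.continuous_height).bddAbove.mono (image_subset_range _ _)).insert 0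

theorem le_legHeight_iff (h : IsFanCoordinates v ρ κ) {c : C} {t : ℝ} (ht : 0 < t) :
    t ≤ legHeight v ρ κ c ↔ ∃ x, x ≠ v ∧ κ x = c ∧ ρ x = t := by
  constructor
  · intro hle
    obtain ⟨_, hu, hlt⟩ := exists_lt_of_lt_csSup (insert_nonempty _ _)
      (show t / 2 < legHeight v ρ κ c by linarith)
    have hK : IsCompact ({x | t / 2 ≤ ρ x} ∩ κ ⁻¹' {c}) :=
      ((h.continuousOn_leg (half_pos ht)).preimage_isClosed_of_isClosed (h.isClosed_le_height _)
        isClosed_singleton).isCompact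
    obtain rfl | ⟨y, ⟨-, hy⟩, rfl⟩ := hu
    · linarith
    obtain ⟨z, ⟨hz1, hz2⟩, hz⟩ := hK.exists_isMaxOn ⟨y, hlt.le, hy⟩ h.continuous_height.continuousOn
    have hz0 : 0 < ρ z := (half_pos ht).trans_le hz1
    have : legHeight v ρ κ c ≤ ρ z := by
      refine csSup_le (insert_nonempty _ _) ?_
      rintro _ (rfl | ⟨w, ⟨-, hw⟩, rfl⟩)
      · exact hz0.le
      · rcases le_total (t / 2) (ρ w) with hw' | hw'
        · exact hz ⟨hw', hw⟩
        · exact hw'.trans hz1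
    obtain ⟨x, hx1, hx2, hx3⟩ := h.exists_lower z (h.ne_of_height_pos hz0) t ht (hle.trans this)
    exact ⟨x, hx1, hx2.trans hz2, hx3⟩
  · rintro ⟨x, hx, hc, rfl⟩
    exact le_csSup (h.bddAbove c) (Or.inr ⟨x, ⟨hx, hc⟩, rfl⟩)

theorem height_le_legHeight (h : IsFanCoordinates v ρ κ) {x : L} (hx : x ≠ v) :
    ρ x ≤ legHeight v ρ κ (κ x) :=
  (h.le_legHeight_iff (h.height_pos hx)).2 ⟨x, hx, rfl, rfl⟩

theorem isLelekFunction_legHeight (h : IsFanCoordinates v ρ κ) :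
    IsLelekFunction (legHeight v ρ κ) := by
  have hnn : ∀ c, 0 ≤ legHeight v ρ κ c := fun c => le_csSup (h.bddAbove c) (mem_insert _ _)
  refine ⟨hnn, ?_, ?_, ?_⟩
  · rw [upperSemicontinuous_iff_isClosed_preimage]
    intro t
    rcases le_or_gt t 0 with ht | ht
    · convert isClosed_univ
      exact eq_univ_of_forall fun c => ht.trans (hnn c)
    · have : legHeight v ρ κ ⁻¹' Ici t = κ '' {x | t ≤ ρ x} := by
        ext c
        simp only [mem_preimage, mem_Ici, h.le_legHeight_iff ht]
        constructor
        · rintro ⟨x, -, rfl, rfl⟩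
          exact ⟨x, le_refl (ρ x), rfl⟩
        · rintro ⟨x, hx, rfl⟩
          exact h.exists_lower x (h.ne_of_height_pos (ht.trans_le hx)) t ht hx
      rw [this]
      exact ((h.isClosed_le_height t).isCompact.image_of_continuousOn
        (h.continuousOn_leg ht)).isClosed
  · intro U hU hne
    obtain ⟨_, hxU, x, hx, rfl⟩ := h.dense_legs.inter_open_nonempty U hU hne
    exact ⟨_, hxU, (h.height_pos hx).trans_le (h.height_le_legHeight hx)⟩
  · intro U hU c hc s hs hsc ε hε
    obtain ⟨x, hx, rfl, rfl⟩ := (h.le_legHeight_iff hs).1 hsc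
    obtain ⟨e, ⟨heU, heb⟩, he, hmax⟩ := h.exists_endpoint x hx
      (κ ⁻¹' U ∩ ρ ⁻¹' Metric.ball (ρ x) ε)
      (inter_mem ((h.continuousAt_leg x hx).preimage_mem_nhds (hU.mem_nhds hc))
        (h.continuous_height.continuousAt.preimage_mem_nhds (Metric.ball_mem_nhds _ hε)))
    refine ⟨κ e, heU, ?_⟩
    have : legHeight v ρ κ (κ e) = ρ e := by
      apply le_antisymm _ (h.height_le_legHeight he)
      refine csSup_le (insert_nonempty _ _) ?_
      rintro _ (rfl | ⟨w, ⟨hw, hwe⟩, rfl⟩)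
      · exact h.height_nonneg e
      · exact hmax w hw hwe
    rw [this]
    exact heb

omit [CompactSpace L] [T2Space C] in
theorem exists_leg_ne (h : IsFanCoordinates v ρ κ) {x : L} (hx : x ≠ v) :
    ∃ y, y ≠ v ∧ κ y ≠ κ x := by
  have hp := h.height_pos hx
  obtain ⟨z, hz, -, hz'⟩ := h.exists_lower x hx (ρ x / 2) (by linarith) (by linarith)
  obtain ⟨e, heU, he, hmax⟩ := h.exists_endpoint z hz (ρ ⁻¹' Iio (ρ x))
    (h.continuous_height.continuousAt.preimage_mem_nhds (Iio_mem_nhds (by linarith)))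
  exact ⟨e, he, fun hk => absurd (hmax x hx hk.symm) (not_le.2 heU)⟩

theorem continuous_of_continuousAt_leg (h : IsFanCoordinates v ρ κ) {Z : Type*} [TopologicalSpace Z]
    {g : Z → L} (hρ : Continuous (ρ ∘ g)) (hκ : ∀ z, g z ≠ v → ContinuousAt (κ ∘ g) z) :
    Continuous g := by
  rw [continuous_iff_ultrafilter]
  intro z F hF
  have hlim : Tendsto g F (𝓝 (F.map g).lim) := (F.map g).le_nhds_lim
  have e1 : ρ (F.map g).lim = ρ (g z) :=
    tendsto_nhds_unique ((h.continuous_height.tendsto _).comp hlim) ((hρ.tendsto z).mono_left hF)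
  suffices (F.map g).lim = g z by rwa [this] at hlim
  by_cases hz : g z = v
  · rw [hz, ← h.height_eq_zero, e1, h.height_eq_zero, hz]
  · have hl : (F.map g).lim ≠ v := by
      rw [Ne, ← h.height_eq_zero, e1, h.height_eq_zero]
      exact hz
    exact h.injective _ _ hl hz (tendsto_nhds_unique ((h.continuousAt_leg _ hl).tendsto.comp hlim)
      ((hκ z hz).tendsto.mono_left hF)) e1

omit [CompactSpace L] [T2Space C] in
open Classical in
theorem continuous_collapse (h : IsFanCoordinates v ρ κ) {D : Set C} (hD : IsClopen D) :
    Continuous fun x => if κ x ∈ D then x else v := by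
  rw [continuous_iff_continuousAt]
  intro x
  by_cases hx : x = v
  · subst hx
    intro U hU
    simp only [ite_self] at hU
    rw [mem_map]
    filter_upwards [hU] with z hz
    change ite _ _ _ ∈ U
    split_ifs
    · exact hz
    · exact mem_of_mem_nhds hU
  · by_cases hxD : κ x ∈ D
    · refine continuousAt_id.congr ?_
      filter_upwards [(h.continuousAt_leg x hx).preimage_mem_nhds (hD.isOpen.mem_nhds hxD)]
        with z hz
      exact (if_pos hz).symm
    · refine continuousAt_const.congr (f := fun _ => v) ?_
      filter_upwards [(h.continuousAt_leg x hx).preimage_mem_nhds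
        (hD.compl.isOpen.mem_nhds hxD)] with z hz
      exact (if_neg hz).symm

end IsFanCoordinates

theorem IsLelekFunction.comp_subtype_val {C : Type*} [TopologicalSpace C] {φ : C → ℝ}
    (hφ : IsLelekFunction φ) {D : Set C} (hD : IsOpen D) :
    IsLelekFunction fun c : D => φ c := by
  refine ⟨fun c => hφ.nonneg c, hφ.usc.comp continuous_subtype_val, ?_, ?_⟩
  · rintro U hU ⟨c, hc⟩
    obtain ⟨_, ⟨d, hd, rfl⟩, hp⟩ := hφ.exists_pos _ (hD.isOpenMap_subtype_val U hU)
      ⟨c, mem_image_of_mem _ hc⟩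
    exact ⟨d, hd, hp⟩
  · intro U hU c hc s hs hsc ε hε
    obtain ⟨_, ⟨d, hd, rfl⟩, hp⟩ := hφ.exists_near _ (hD.isOpenMap_subtype_val U hU) c
      (mem_image_of_mem _ hc) s hs hsc ε hε
    exact ⟨d, hd, hp⟩

theorem IsFanCoordinates.exists_retract {L C : Type*} [TopologicalSpace L] [CompactSpace L]
    [T2Space L] [TopologicalSpace C] [CompactSpace C] [T2Space C] [TotallyDisconnectedSpace C]
    {v : L} {ρ : L → ℝ} {κ : L → C} (h : IsFanCoordinates v ρ κ) {x₀ : L} (hx₀ : x₀ ≠ v)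
    {B : ℕ → Set C} (hB : ∀ n, IsClopen (B n))
    (hBsep : ∀ x y, (∀ n, x ∈ B n ↔ y ∈ B n) → x = y) :
    ∃ f : L → L, IsEmbedding f ∧ ¬ Function.Surjective f ∧
      ∃ r : L → L, Continuous r ∧ (∀ x, r x ∈ range f) ∧ ∀ x ∈ range f, r x = x := by
  classical
  obtain ⟨y₀, hy₀, hne⟩ := h.exists_leg_ne hx₀
  obtain ⟨D, hD, hxD, hyD⟩ := compact_exists_isClopen_in_isOpen
    (isOpen_compl_singleton (x := κ y₀)) (x := κ x₀) (Ne.symm hne)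
  replace hyD : κ y₀ ∉ D := fun hy => hyD hy rfl
  have : CompactSpace D := isCompact_iff_compactSpace.1 hD.isClosed.isCompact
  have : Nonempty C := ⟨κ x₀⟩
  have : Nonempty D := ⟨⟨κ x₀, hxD⟩⟩
  have hφ := h.isLelekFunction_legHeight
  obtain ⟨β, a, ha, hβ⟩ := hφ.exists_homeomorph (hφ.comp_subtype_val hD.isOpen) hB hBsep
    (fun n => (hB n).preimage continuous_subtype_val)
    (fun x y hxy => Subtype.ext (hBsep x y hxy))
  have hf : ∀ x, ∃ y, ρ y = Real.exp (a (κ x)) * ρ x ∧ (x ≠ v → y ≠ v ∧ κ y = β (κ x)) := by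
    intro x
    by_cases hx : x = v
    · exact ⟨v, by simp [hx, (h.height_eq_zero v).2 rfl], fun h' => absurd hx h'⟩
    · have hpos := h.height_pos hx
      obtain ⟨y, hy, hy1, hy2⟩ := (h.le_legHeight_iff (c := (β (κ x) : C))
        (t := Real.exp (a (κ x)) * ρ x) (by positivity)).1 (by
          rw [hβ]
          gcongr
          exact h.height_le_legHeight hx)
      exact ⟨y, hy2, fun _ => ⟨hy, hy1⟩⟩
  choose f hfρ hfκ using hf
  have hfv : f v = v := by
    rw [← h.height_eq_zero, hfρ, (h.height_eq_zero v).2 rfl, mul_zero]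
  have hfcont : Continuous f := by
    apply h.continuous_of_continuousAt_leg
    · obtain ⟨M, hM⟩ := (isCompact_range ha).bddAbove
      have e : ρ ∘ f = fun x => Real.exp (a (κ x)) * ρ x := funext hfρ
      rw [e, continuous_iff_continuousAt]
      intro x
      by_cases hx : x = v
      · subst hx
        have h0 : ρ x = 0 := (h.height_eq_zero x).2 rfl
        rw [ContinuousAt, h0, mul_zero]
        refine squeeze_zero (g := fun z => Real.exp M * ρ z)
          (fun z => mul_nonneg (Real.exp_pos _).le (h.height_nonneg z))
          (fun z => mul_le_mul_of_nonneg_right (Real.exp_le_exp.2 (hM (mem_range_self _)))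
            (h.height_nonneg z)) ?_
        have := (h.continuous_height.tendsto x).const_mul (Real.exp M)
        rwa [h0, mul_zero] at this
      · exact (Real.continuous_exp.continuousAt.comp
          (ha.continuousAt.comp (h.continuousAt_leg x hx))).mul h.continuous_height.continuousAt
    · intro x hx
      have hxv : x ≠ v := fun e => hx (by rw [e, hfv])
      refine ContinuousAt.congr (f := fun z => (β (κ z) : C))
        ((continuous_subtype_val.comp β.continuous).continuousAt.comp (h.continuousAt_leg x hxv)) ?_
      have hop : {z | 0 < ρ z} ∈ 𝓝 x :=
        (isOpen_lt continuous_const h.continuous_height).mem_nhds (h.height_pos hxv)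
      filter_upwards [hop] with z hz
      exact (hfκ z (h.ne_of_height_pos hz)).2.symm
  have hfne : ∀ x, f x = v → x = v := fun x hx => by
    by_contra hxv
    exact (hfκ x hxv).1 hx
  have hinj : Function.Injective f := by
    intro x y hxy
    by_cases hx : x = v
    · rw [hx, hfv] at hxy
      rw [hx, hfne y hxy.symm]
    · have hy : y ≠ v := fun e => hx (hfne x (by rw [hxy, e, hfv]))
      have hk : κ x = κ y := β.injective (Subtype.ext (by rw [← (hfκ x hx).2, hxy, (hfκ y hy).2]))
      have hr := hfρ x
      rw [hxy, hfρ y, hk] at hr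
      exact h.injective x y hx hy hk (mul_left_cancel₀ (Real.exp_pos _).ne' hr).symm
  have hfD : ∀ x, x ≠ v → κ (f x) ∈ D := fun x hx => by
    rw [(hfκ x hx).2]
    exact (β (κ x)).2
  refine ⟨f, (hfcont.isClosedEmbedding hinj).isEmbedding, fun hs => ?_,
    fun x => if κ x ∈ D then x else v, h.continuous_collapse hD, fun y => ?_, ?_⟩
  · obtain ⟨x, rfl⟩ := hs y₀
    exact hyD (hfD x fun e => hy₀ (by rw [e, hfv]))
  · change ite _ _ _ ∈ range f
    split_ifs with hy
    · by_cases hyv : y = v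
      · exact ⟨v, by rw [hfv, hyv]⟩
      · have hpos := h.height_pos hyv
        set c := β.symm ⟨κ y, hy⟩ with hc
        have hβc : β c = ⟨κ y, hy⟩ := β.apply_symm_apply _
        have hle := h.height_le_legHeight hyv
        have := hβ c
        rw [hβc] at this
        rw [this] at hle
        obtain ⟨x, hx, hxc, hxρ⟩ := (h.le_legHeight_iff (c := c) (t := ρ y / Real.exp (a c))
          (by positivity)).1 (by rwa [div_le_iff₀' (Real.exp_pos _)])
        refine ⟨x, h.injective _ _ (hfκ x hx).1 hyv ?_ ?_⟩
        · rw [(hfκ x hx).2, hxc, hβc]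
        · rw [hfρ, hxρ, hxc, mul_div_cancel₀ _ (Real.exp_pos _).ne']
    · exact ⟨v, hfv⟩
  · rintro _ ⟨x, rfl⟩
    by_cases hx : x = v
    · simp [hx, hfv]
    · exact if_pos (hfD x hx)

end Coordinates

section LegSystems

/-- The family of segments `J x` from the top `v` to the points `x` of a smooth fan whose endpoints
are dense. -/
structure IsLegSystem {L : Type*} [MetricSpace L] (v : L) (J : L → Set L) : Prop where
  self_mem : ∀ x, x ∈ J x
  top_mem : ∀ x, v ∈ J x
  isCompact : ∀ x, IsCompact (J x)
  isPreconnected_upper : ∀ x U, U ⊆ J x → (∀ y ∈ U, ∀ z ∈ J x, y ∈ J z → z ∈ U) →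
    IsPreconnected U
  subset : ∀ x y, y ∈ J x → J y ⊆ J x
  antisymm : ∀ x y, x ∈ J y → y ∈ J x → x = y
  chain : ∀ K, IsCompact K → IsPreconnected K → v ∉ K → ∀ x ∈ K, ∀ y ∈ K, x ∈ J y ∨ y ∈ J x
  tendsto : ∀ (xs : ℕ → L) x, Tendsto xs atTop (𝓝 x) →
    Tendsto (fun n => Metric.hausdorffDist (J (xs n)) (J x)) atTop (𝓝 0)
  exists_endpoint : ∀ x, ∀ U ∈ 𝓝 x, ∃ e ∈ U, ∀ y, e ≠ v → e ∈ J y → e = y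

/-- A Whitney-type height of the segment `J x`. -/
noncomputable def segmentHeight {L : Type*} [MetricSpace L] (v : L) (J : L → Set L) (p : ℕ → L)
    (x : L) : ℝ :=
  ∑' i, (1 / 2 : ℝ) ^ i * (dist (p i) v - Metric.infDist (p i) (J x))

/-- `Q` is relatively clopen in `A`. -/
def IsRelClopen {L : Type*} [TopologicalSpace L] (A Q : Set L) : Prop :=
  Q ⊆ A ∧ IsClosed Q ∧ IsClosed (A \ Q)

namespace IsLegSystem

variable {L : Type*} [MetricSpace L] {v : L} {J : L → Set L}

theorem eq_top (h : IsLegSystem v J) {x : L} (hx : x ∈ J v) : x = v :=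
  h.antisymm x v hx (h.top_mem x)

theorem isPreconnected_between (h : IsLegSystem v J) (x y : L) :
    IsPreconnected {z | z ∈ J y ∧ x ∈ J z} :=
  h.isPreconnected_upper y _ (fun _ hz => hz.1) fun z hz w hw hzw => ⟨hw, h.subset w z hzw hz.2⟩

theorem continuous_infDist [CompactSpace L] (h : IsLegSystem v J) (p : L) :
    Continuous fun x => Metric.infDist p (J x) := by
  rw [continuous_iff_seqContinuous]
  intro xs x hxs
  have hfin : ∀ a b, Metric.hausdorffEDist (J a) (J b) ≠ ⊤ := fun a b =>
    Metric.hausdorffEDist_ne_top_of_nonempty_of_bounded ⟨v, h.top_mem a⟩ ⟨v, h.top_mem b⟩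
      (h.isCompact a).isBounded (h.isCompact b).isBounded
  rw [tendsto_iff_dist_tendsto_zero]
  refine squeeze_zero (fun _ => dist_nonneg) (fun n => ?_) (h.tendsto xs x hxs)
  have h1 := Metric.infDist_le_infDist_add_hausdorffDist (x := p) (hfin (xs n) x)
  have h2 := Metric.infDist_le_infDist_add_hausdorffDist (x := p) (hfin x (xs n))
  rw [Metric.hausdorffDist_comm] at h2
  rw [Real.dist_eq, abs_le]
  simp only [Function.comp_apply]
  constructor <;> linarith

theorem height_term_nonneg (h : IsLegSystem v J) (p x : L) :
    0 ≤ dist p v - Metric.infDist p (J x) :=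
  sub_nonneg.2 (Metric.infDist_le_dist_of_mem (h.top_mem x))

theorem norm_height_term_le [CompactSpace L] (h : IsLegSystem v J) (p : ℕ → L) (i : ℕ) (x : L) :
    ‖(1 / 2 : ℝ) ^ i * (dist (p i) v - Metric.infDist (p i) (J x))‖ ≤
      (1 / 2 : ℝ) ^ i * Metric.diam (univ : Set L) := by
  rw [norm_mul, Real.norm_of_nonneg (h.height_term_nonneg _ _), Real.norm_of_nonneg (by positivity)]
  gcongr
  have := Metric.dist_le_diam_of_mem isCompact_univ.isBounded (mem_univ (p i)) (mem_univ v)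
  linarith [Metric.infDist_nonneg (x := p i) (s := J x)]

theorem summable_bound : Summable fun i : ℕ => (1 / 2 : ℝ) ^ i * Metric.diam (univ : Set L) :=
  summable_geometric_two.mul_right _

theorem continuous_segmentHeight [CompactSpace L] (h : IsLegSystem v J) (p : ℕ → L) :
    Continuous (segmentHeight v J p) :=
  continuous_tsum
    (fun i => continuous_const.mul (continuous_const.sub (h.continuous_infDist (p i))))
    summable_bound (h.norm_height_term_le p)

theorem segmentHeight_lt [CompactSpace L] (h : IsLegSystem v J) {p : ℕ → L} (hp : DenseRange p)
    {x y : L} (hxy : x ∈ J y) (hne : x ≠ y) : segmentHeight v J p x < segmentHeight v J p y := by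
  have hyx : y ∉ J x := fun hy => hne (h.antisymm x y hxy hy)
  have hpos : 0 < Metric.infDist y (J x) :=
    ((h.isCompact x).isClosed.notMem_iff_infDist_pos ⟨v, h.top_mem x⟩).1 hyx
  obtain ⟨i, hi⟩ := hp.exists_dist_lt y (half_pos hpos)
  have hs : ∀ x, Summable fun i => (1 / 2 : ℝ) ^ i * (dist (p i) v - Metric.infDist (p i) (J x)) :=
    fun x => Summable.of_norm_bounded summable_bound fun i => h.norm_height_term_le p i x
  refine Summable.tsum_lt_tsum (i := i) (fun j => ?_) ?_ (hs x) (hs y)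
  · have := Metric.infDist_le_infDist_of_subset (x := p j) (h.subset y x hxy) ⟨v, h.top_mem x⟩
    gcongr
  · have h1 : Metric.infDist (p i) (J y) ≤ dist (p i) y :=
      Metric.infDist_le_dist_of_mem (h.self_mem y)
    have h2 : Metric.infDist y (J x) ≤ Metric.infDist (p i) (J x) + dist y (p i) :=
      Metric.infDist_le_infDist_add_dist
    rw [dist_comm] at h1
    gcongr 1
    linarith

theorem segmentHeight_top (h : IsLegSystem v J) (p : ℕ → L) : segmentHeight v J p v = 0 := by
  have : J v = {v} := by
    ext x
    exact ⟨h.eq_top, fun e => e ▸ h.top_mem v⟩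
  simp [segmentHeight, this]

theorem exists_isRelClopen [CompactSpace L] (h : IsLegSystem v J) {A : Set L} (hA : IsClosed A)
    (hvA : v ∉ A) {F G : Set L} (hF : IsClosed F) (hG : IsClosed G) (hFA : F ⊆ A)
    (hFG : ∀ x ∈ F, ∀ y ∈ G, ¬ (x ∈ J y ∨ y ∈ J x)) :
    ∃ Q, IsRelClopen A Q ∧ F ⊆ Q ∧ Disjoint G Q := by
  have : CompactSpace A := isCompact_iff_compactSpace.1 hA.isCompact
  have hcont : Continuous ((↑) : A → ConnectedComponents A) := ConnectedComponents.continuous_coe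
  have hcl : ∀ S : Set L, IsClosed S →
      IsClosed (((↑) : A → ConnectedComponents A) '' (Subtype.val ⁻¹' S)) := fun S hS =>
    ((hS.preimage continuous_subtype_val).isCompact.image hcont).isClosed
  obtain ⟨E, hE, hFE, hEG⟩ := exists_clopen_of_closed_subset_open (hcl F hF) (hcl G hG).isOpen_compl
    (by
      rintro _ ⟨x, hx, rfl⟩ ⟨y, hy, hxy⟩
      rw [ConnectedComponents.coe_eq_coe'] at hxy
      refine hFG x hx y hy (h.chain (Subtype.val '' connectedComponent x)
        (isClosed_connectedComponent.isCompact.image continuous_subtype_val)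
        (isPreconnected_connectedComponent.image _ continuous_subtype_val.continuousOn) ?_
        x ⟨x, mem_connectedComponent, rfl⟩ y ⟨y, hxy, rfl⟩)
      rintro ⟨z, -, hz⟩
      exact hvA (hz ▸ z.2))
  have hval : ∀ S : Set (ConnectedComponents A), IsClosed S →
      IsClosed (Subtype.val '' (((↑) : A → ConnectedComponents A) ⁻¹' S)) := fun S hS =>
    hA.isClosedEmbedding_subtypeVal.isClosedMap _ (hS.preimage hcont)
  refine ⟨Subtype.val '' (((↑) : A → ConnectedComponents A) ⁻¹' E), ⟨?_, hval E hE.isClosed, ?_⟩,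
    fun x hx => ⟨⟨x, hFA hx⟩, hFE ⟨⟨x, hFA hx⟩, hx, rfl⟩, rfl⟩, ?_⟩
  · rintro _ ⟨x, -, rfl⟩
    exact x.2
  · convert hval Eᶜ hE.compl.isClosed using 1
    ext x
    by_cases hx : x ∈ A <;> simp [hx]
  · rw [disjoint_left]
    rintro _ hx ⟨y, hy, rfl⟩
    exact hEG hy ⟨y, hx, rfl⟩

theorem mem_of_isRelClopen (h : IsLegSystem v J) {A Q : Set L}
    (hA : ∀ x ∈ A, ∀ y, x ∈ J y → y ∈ A) (hQ : IsRelClopen A Q) {x y : L} (hx : x ∈ A) (hy : y ∈ A)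
    (hxy : x ∈ J y ∨ y ∈ J x) : x ∈ Q ↔ y ∈ Q := by
  wlog hle : x ∈ J y generalizing x y
  · exact (this hy hx hxy.symm (hxy.resolve_left hle)).symm
  have hpre := isPreconnected_closed_iff.1 (h.isPreconnected_between x y) Q (A \ Q) hQ.2.1 hQ.2.2
    (fun z hz => by
      by_cases hzQ : z ∈ Q
      · exact Or.inl hzQ
      · exact Or.inr ⟨hA x hx z hz.2, hzQ⟩)
  have hxm : x ∈ {z | z ∈ J y ∧ x ∈ J z} := ⟨hle, h.self_mem x⟩
  have hym : y ∈ {z | z ∈ J y ∧ x ∈ J z} := ⟨h.self_mem y, hle⟩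
  constructor
  · intro hxQ
    by_contra hyQ
    obtain ⟨z, -, hz, -, hz'⟩ := hpre ⟨x, hxm, hxQ⟩ ⟨y, hym, hy, hyQ⟩
    exact hz' hz
  · intro hyQ
    by_contra hxQ
    obtain ⟨z, -, hz, -, hz'⟩ := hpre ⟨y, hym, hyQ⟩ ⟨x, hxm, hx, hxQ⟩
    exact hz' hz

theorem exists_isRelClopen_extend [CompactSpace L] (h : IsLegSystem v J) {A A' Q : Set L}
    (hA : ∀ x ∈ A, ∀ y, x ∈ J y → y ∈ A) (hA' : IsClosed A') (hv : v ∉ A') (hAA' : A ⊆ A')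
    (hQ : IsRelClopen A Q) : ∃ Q', IsRelClopen A' Q' ∧ ∀ x ∈ A, x ∈ Q' ↔ x ∈ Q := by
  obtain ⟨Q', hQ', hF, hG⟩ := h.exists_isRelClopen hA' hv hQ.2.1 hQ.2.2 (hQ.1.trans hAA')
    fun x hx y hy hxy => hy.2 ((h.mem_of_isRelClopen hA hQ (hQ.1 hx) hy.1 hxy).1 hx)
  refine ⟨Q', hQ', fun x hx => ⟨fun hx' => ?_, fun hx' => hF hx'⟩⟩
  by_contra hxQ
  exact disjoint_left.1 hG ⟨hx, hxQ⟩ hx'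

theorem exists_separating [CompactSpace L] (h : IsLegSystem v J) {ρ : L → ℝ} (hρ : Continuous ρ)
    (hlt : ∀ x y, x ∈ J y → x ≠ y → ρ x < ρ y) (hρv : ρ v = 0) {x y : L}
    (hxy : ¬ (x ∈ J y ∨ y ∈ J x)) :
    ∃ W : Set L, IsOpen W ∧ IsOpen ({v}ᶜ \ W) ∧ v ∉ W ∧ x ∈ W ∧ y ∉ W := by
  have hpos : ∀ z, z ≠ v → 0 < ρ z := fun z hz => hρv ▸ hlt v z (h.top_mem z) hz.symm
  have hxv : x ≠ v := fun e => hxy (Or.inl (e ▸ h.top_mem y))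
  have hyv : y ≠ v := fun e => hxy (Or.inr (e ▸ h.top_mem x))
  set d := min (ρ x) (ρ y) with hd
  have hd0 : 0 < d := lt_min (hpos x hxv) (hpos y hyv)
  set A : ℕ → Set L := fun n => {z | d / (n + 1) ≤ ρ z} with hAdef
  have hAcl : ∀ n, IsClosed (A n) := fun n => isClosed_le continuous_const hρ
  have hAv : ∀ n, v ∉ A n := fun n hn => by
    have : d / (n + 1) ≤ ρ v := hn
    have : 0 < d / ((n : ℝ) + 1) := by positivity
    linarith
  have hAup : ∀ n, ∀ z ∈ A n, ∀ w, z ∈ J w → w ∈ A n := fun n z hz w hzw => by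
    by_cases e : z = w
    · exact e ▸ hz
    · exact le_trans (show _ ≤ ρ z from hz) (hlt z w hzw e).le
  have hAmono : Monotone A := fun m n hmn z hz => by
    refine le_trans ?_ (show _ ≤ ρ z from hz)
    gcongr
  have hAev : ∀ z, z ≠ v → ∃ n : ℕ, d / (n + 1) < ρ z := fun z hz => by
    obtain ⟨n, hn⟩ := exists_nat_one_div_lt (div_pos (hpos z hz) hd0)
    refine ⟨n, ?_⟩
    rw [lt_div_iff₀ hd0] at hn
    calc d / (n + 1) = 1 / (n + 1) * d := by ring
      _ < ρ z := hn
  have hx0 : x ∈ A 0 := by simp [hAdef, hd]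
  have hy0 : y ∈ A 0 := by simp [hAdef, hd]
  obtain ⟨Q₀, hQ₀, hxQ, hyQ⟩ := h.exists_isRelClopen (hAcl 0) (hAv 0) (isClosed_singleton (x := x))
    (isClosed_singleton (x := y)) (singleton_subset_iff.2 hx0) (by rintro _ rfl _ rfl; exact hxy)
  choose next hnext hnext_iff using fun (n : ℕ) (Q : {Q // IsRelClopen (A n) Q}) =>
    h.exists_isRelClopen_extend (hAup n) (hAcl (n + 1)) (hAv (n + 1)) (hAmono n.le_succ) Q.2
  let S : ∀ n, {Q // IsRelClopen (A n) Q} := fun n =>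
    Nat.rec ⟨Q₀, hQ₀⟩ (fun n Q => ⟨next n Q, hnext n Q⟩) n
  have hS : ∀ n, ∀ z ∈ A n, z ∈ (S (n + 1)).1 ↔ z ∈ (S n).1 := fun n => hnext_iff n (S n)
  have hle : ∀ m n, m ≤ n → ∀ z ∈ A m, z ∈ (S n).1 ↔ z ∈ (S m).1 := fun m n hmn z hz => by
    induction n, hmn using Nat.le_induction with
    | base => rfl
    | succ n hmn ih => rw [hS n z (hAmono hmn hz), ih]
  have hW : ∀ n, ∀ z ∈ A n, z ∈ ⋃ m, (S m).1 ↔ z ∈ (S n).1 := fun n z hz => by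
    refine ⟨fun hzW => ?_, fun hzS => mem_iUnion.2 ⟨n, hzS⟩⟩
    obtain ⟨m, hm⟩ := mem_iUnion.1 hzW
    rcases le_total m n with hmn | hmn
    · exact (hle m n hmn z ((S m).2.1 hm)).2 hm
    · exact (hle n m hmn z hz).1 hm
  have hvW : v ∉ ⋃ m, (S m).1 := fun hv => by
    obtain ⟨m, hm⟩ := mem_iUnion.1 hv
    exact hAv m ((S m).2.1 hm)
  refine ⟨⋃ m, (S m).1, ?_, ?_, hvW, mem_iUnion.2 ⟨0, hxQ rfl⟩,
    fun hy => disjoint_left.1 hyQ rfl ((hW 0 y hy0).1 hy)⟩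
  · rw [isOpen_iff_mem_nhds]
    intro z hz
    obtain ⟨n, hn⟩ := hAev z fun e => hvW (e ▸ hz)
    filter_upwards [(isOpen_lt continuous_const hρ).mem_nhds hn,
      (S n).2.2.2.isOpen_compl.mem_nhds fun hz' => hz'.2 ((hW n z hn.le).1 hz)] with w hw hw'
    by_contra hwW
    exact hw' ⟨le_of_lt hw, fun hwS => hwW ((hW n w (le_of_lt hw)).2 hwS)⟩
  · rw [isOpen_iff_mem_nhds]
    rintro z ⟨hzv, hz⟩
    obtain ⟨n, hn⟩ := hAev z hzv
    filter_upwards [(isOpen_lt continuous_const hρ).mem_nhds hn,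
      (S n).2.2.1.isOpen_compl.mem_nhds fun hz' => hz ((hW n z hn.le).2 hz')] with w hw hw'
    refine ⟨?_, fun hwW => hw' ((hW n w (le_of_lt hw)).1 hwW)⟩
    rintro rfl
    exact hAv n (le_of_lt hw)

/-- Countably many sets that are clopen off the top tell the legs apart. -/
theorem exists_separating_sequence [CompactSpace L] (h : IsLegSystem v J) {ρ : L → ℝ}
    (hρ : Continuous ρ) (hlt : ∀ x y, x ∈ J y → x ≠ y → ρ x < ρ y) (hρv : ρ v = 0) :
    ∃ w : ℕ → Set L, (∀ n, IsOpen (w n) ∧ IsOpen ({v}ᶜ \ w n)) ∧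
      ∀ x y, x ≠ v → y ≠ v → (∀ n, x ∈ w n ↔ y ∈ w n) → x ∈ J y ∨ y ∈ J x := by
  let 𝒲 : Set (Set L) := {W | IsOpen W ∧ IsOpen ({v}ᶜ \ W)}
  obtain ⟨T, hT𝒲, hTc, hT⟩ := TopologicalSpace.isOpen_biUnion_countable 𝒲
    (fun W => W ×ˢ ({v}ᶜ \ W)) fun W hW => hW.1.prod hW.2
  have hne : (insert ∅ T).Nonempty := insert_nonempty _ _
  obtain ⟨w, hw⟩ := (hTc.insert ∅).exists_eq_range hne
  refine ⟨w, fun n => ?_, fun x y hx hy hxy => ?_⟩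
  · have hn : w n ∈ insert ∅ T := hw ▸ mem_range_self n
    obtain e | hn := hn
    · rw [e]
      simp
    · exact hT𝒲 hn
  · by_contra hcon
    obtain ⟨W, hW, hW', -, hxW, hyW⟩ := h.exists_separating hρ hlt hρv hcon
    have hmem : (x, y) ∈ ⋃ W ∈ 𝒲, W ×ˢ ({v}ᶜ \ W) :=
      mem_biUnion (show W ∈ 𝒲 from ⟨hW, hW'⟩) ⟨hxW, hy, hyW⟩
    rw [← hT] at hmem
    obtain ⟨V, hV, hxV, -, hyV⟩ := mem_iUnion₂.1 hmem
    obtain ⟨n, rfl⟩ : V ∈ range w := hw ▸ mem_insert_of_mem _ hV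
    exact hyV ((hxy n).1 hxV)

theorem mem_iff_of_comparable (h : IsLegSystem v J) {W : Set L} (hW : IsOpen W)
    (hW' : IsOpen ({v}ᶜ \ W)) {x y : L} (hx : x ≠ v) (hxy : x ∈ J y) : x ∈ W ↔ y ∈ W := by
  have hpre := h.isPreconnected_between x y
  have hsub : {z | z ∈ J y ∧ x ∈ J z} ⊆ W ∪ ({v}ᶜ \ W) := fun z hz => by
    by_cases hzW : z ∈ W
    · exact Or.inl hzW
    · refine Or.inr ⟨?_, hzW⟩
      rintro rfl
      exact hx (h.eq_top hz.2)
  have hdisj : Disjoint W ({v}ᶜ \ W) := disjoint_sdiff_right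
  have hxm : x ∈ {z | z ∈ J y ∧ x ∈ J z} := ⟨hxy, h.self_mem x⟩
  have hym : y ∈ {z | z ∈ J y ∧ x ∈ J z} := ⟨h.self_mem y, hxy⟩
  exact ⟨fun hxW => hpre.subset_left_of_subset_union hW hW' hdisj hsub ⟨x, hxm, hxW⟩ hym,
    fun hyW => hpre.subset_left_of_subset_union hW hW' hdisj hsub ⟨y, hym, hyW⟩ hxm⟩

theorem exists_retract [CompactSpace L] (h : IsLegSystem v J) {x₀ : L} (hx₀ : x₀ ≠ v) :
    ∃ f : L → L, IsEmbedding f ∧ ¬ Function.Surjective f ∧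
      ∃ r : L → L, Continuous r ∧ (∀ x, r x ∈ range f) ∧ ∀ x ∈ range f, r x = x := by
  classical
  have : Nonempty L := ⟨v⟩
  set ρ := segmentHeight v J (TopologicalSpace.denseSeq L)
  have hρ : Continuous ρ := h.continuous_segmentHeight _
  have hlt : ∀ x y, x ∈ J y → x ≠ y → ρ x < ρ y := fun x y hxy hne =>
    h.segmentHeight_lt (TopologicalSpace.denseRange_denseSeq L) hxy hne
  have hle : ∀ x y, x ∈ J y → ρ x ≤ ρ y := fun x y hxy => by
    by_cases e : x = y
    · rw [e]
    · exact (hlt x y hxy e).le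
  have hρv : ρ v = 0 := h.segmentHeight_top _
  have hpos : ∀ z, z ≠ v → 0 < ρ z := fun z hz => hρv ▸ hlt v z (h.top_mem z) hz.symm
  obtain ⟨w, hw, hsep⟩ := h.exists_separating_sequence hρ hlt hρv
  let κ₀ : L → ℕ → Bool := fun x n => decide (x ∈ w n)
  let C : Set (ℕ → Bool) := closure (κ₀ '' {v}ᶜ)
  have : CompactSpace C := isCompact_iff_compactSpace.1 isClosed_closure.isCompact
  let κ : L → C := fun x =>
    if hx : x = v then ⟨κ₀ x₀, subset_closure ⟨x₀, hx₀, rfl⟩⟩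
    else ⟨κ₀ x, subset_closure ⟨x, hx, rfl⟩⟩
  have hκ : ∀ x, x ≠ v → (κ x : ℕ → Bool) = κ₀ x := fun x hx => by simp [κ, hx]
  have hκeq : ∀ x y, x ≠ v → y ≠ v → (κ x = κ y ↔ x ∈ J y ∨ y ∈ J x) := by
    intro x y hx hy
    have hiff : κ x = κ y ↔ ∀ n, x ∈ w n ↔ y ∈ w n := by
      rw [Subtype.ext_iff, hκ x hx, hκ y hy, funext_iff]
      simp [κ₀]
    rw [hiff]
    refine ⟨hsep x y hx hy, ?_⟩
    rintro (hxy | hxy) n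
    · exact h.mem_iff_of_comparable (hw n).1 (hw n).2 hx hxy
    · exact (h.mem_iff_of_comparable (hw n).1 (hw n).2 hy hxy).symm
  have hcoords : IsFanCoordinates v ρ κ := by
    refine ⟨hρ, fun x => hρv ▸ hle v x (h.top_mem x), fun x => ⟨fun e => ?_, fun e => e ▸ hρv⟩,
      fun x hx => ?_, ?_, fun x y hx hy hκxy hρxy => ?_, fun x hx s hs hsx => ?_,
      fun x hx U hU => ?_⟩
    · by_contra hx
      exact (hpos x hx).ne' e
    · rw [IsInducing.subtypeVal.continuousAt_iff, continuousAt_pi]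
      intro n
      refine (continuousAt_const (y := κ₀ x n)).congr ?_
      have hxn : (if x ∈ w n then w n else {v}ᶜ \ w n) ∈ 𝓝 x := by
        split_ifs with hxw
        · exact (hw n).1.mem_nhds hxw
        · exact (hw n).2.mem_nhds ⟨hx, hxw⟩
      filter_upwards [hxn, isOpen_compl_singleton.mem_nhds hx] with z hz hzv
      rw [Function.comp_apply, hκ z hzv]
      split_ifs at hz with hxw
      · simp [κ₀, hxw, hz]
      · simp [κ₀, hxw, hz.2]
    · rw [Subtype.dense_iff]
      intro c hc
      refine closure_mono ?_ hc
      rintro _ ⟨x, hx, rfl⟩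
      exact ⟨κ x, ⟨x, hx, rfl⟩, hκ x hx⟩
    · by_contra hne
      rcases (hκeq x y hx hy).1 hκxy with hxy | hxy
      · exact (hlt x y hxy hne).ne hρxy
      · exact (hlt y x hxy (Ne.symm hne)).ne' hρxy
    · have hpre : IsPreconnected (J x) :=
        h.isPreconnected_upper x _ subset_rfl fun _ _ z hz _ => hz
      obtain ⟨y, hy, rfl⟩ := hpre.intermediate_value (h.top_mem x) (h.self_mem x) hρ.continuousOn
        ⟨hρv ▸ hs.le, hsx⟩
      have hyv : y ≠ v := fun e => hs.ne' (e ▸ hρv)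
      exact ⟨y, hyv, (hκeq y x hyv hx).2 (Or.inl hy), rfl⟩
    · obtain ⟨e, ⟨heU, hev⟩, he⟩ :=
        h.exists_endpoint x (U ∩ {v}ᶜ) (inter_mem hU (isOpen_compl_singleton.mem_nhds hx))
      refine ⟨e, heU, hev, fun y hy hκy => ?_⟩
      rcases (hκeq y e hy hev).1 hκy with hye | hye
      · exact hle y e hye
      · exact (he y hev hye) ▸ le_rfl
  refine hcoords.exists_retract hx₀ (B := fun n => {c | c.1 n = true})
    (fun n => (isClopen_discrete {true}).preimage
      ((continuous_apply n).comp continuous_subtype_val))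
    fun x y hxy => Subtype.ext (funext fun n => Bool.eq_iff_iff.2 (hxy n))

end IsLegSystem

end LegSystems

section Dendroids

theorem homeomorph_unitInterval_zero (g : unitInterval ≃ₜ unitInterval) : g 0 = 0 ∨ g 0 = 1 := by
  obtain ⟨t, ht⟩ := g.surjective 0
  obtain ⟨u, hu⟩ := g.surjective 1
  rcases g.continuous.strictMono_of_inj_boundedOrder' g.injective with h | h
  · exact Or.inl (le_antisymm ((h.monotone unitInterval.nonneg').trans_eq ht) unitInterval.nonneg')
  · exact Or.inr (le_antisymm unitInterval.le_one'
      (hu.symm.trans_le (h.antitone unitInterval.nonneg')))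

variable {X : Type*} [TopologicalSpace X]

/-- The smallest subcontinuum containing `v` and `x`. -/
def spanningContinuum (v x : X) : Set X :=
  ⋂₀ {K | IsSubcontinuum K ∧ v ∈ K ∧ x ∈ K}

theorem isEndpointOfArc_eq {A : Set X} (φ : unitInterval ≃ₜ A) {x : X} (hx : IsEndpointOfArc A x) :
    x = φ 0 ∨ x = φ 1 := by
  obtain ⟨ψ, rfl⟩ := hx
  have := homeomorph_unitInterval_zero (ψ.trans φ.symm)
  simp only [Homeomorph.trans_apply, φ.symm_apply_eq] at this
  rcases this with h | h
  · exact Or.inl (congrArg Subtype.val h)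
  · exact Or.inr (congrArg Subtype.val h)

theorem exists_parametrization {A : Set X} {x y : X} (hxy : x ≠ y) (hx : IsEndpointOfArc A x)
    (hy : IsEndpointOfArc A y) : ∃ φ : unitInterval ≃ₜ A, (φ 0 : X) = x ∧ (φ 1 : X) = y := by
  obtain ⟨φ, rfl⟩ := hx
  exact ⟨φ, rfl, ((isEndpointOfArc_eq φ hy).resolve_left hxy.symm).symm⟩

theorem isArcFromTo_range [T2Space X] {γ : unitInterval → X} (hγ : Continuous γ)
    (hinj : Function.Injective γ) : IsArcFromTo (range γ) (γ 0) (γ 1) := by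
  let φ : unitInterval ≃ₜ range γ := (hγ.isClosedEmbedding hinj).isEmbedding.toHomeomorph
  refine Or.inr ⟨hinj.ne zero_ne_one, ⟨φ.symm⟩, ⟨φ, rfl⟩,
    ⟨unitInterval.symmHomeomorph.trans φ, ?_⟩⟩
  exact congrArg γ unitInterval.symm_zero

theorem IsDendroid.isConnected_inter (hX : IsDendroid (univ : Set X)) {A B : Set X}
    (hA : IsSubcontinuum A) (hB : IsSubcontinuum B) (hAB : (A ∩ B).Nonempty) :
    IsConnected (A ∩ B) :=
  hX.2.2 (A ∪ B) (subset_univ _) ⟨hA.1.union hB.1, IsConnected.union hAB hA.2 hB.2⟩ A B hA hB rfl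

theorem spanningContinuum_self (v : X) : spanningContinuum v v = {v} :=
  subset_antisymm (sInter_subset_of_mem ⟨⟨isCompact_singleton, isConnected_singleton⟩, rfl, rfl⟩)
    (singleton_subset_iff.2 fun _ hK => hK.2.1)

theorem mem_spanningContinuum (v x : X) : x ∈ spanningContinuum v x := fun _ hK => hK.2.2

theorem top_mem_spanningContinuum (v x : X) : v ∈ spanningContinuum v x := fun _ hK => hK.2.1

theorem spanningContinuum_subset {v x y : X} (hy : y ∈ spanningContinuum v x) :
    spanningContinuum v y ⊆ spanningContinuum v x :=
  fun _ hz K hK => hz K ⟨hK.1, hK.2.1, hy K hK⟩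

/-- `γ` runs through the smallest subcontinuum containing `v` and `x`, from `v` to `x`. -/
structure IsSpanningPath (v x : X) (γ : unitInterval → X) : Prop where
  continuous : Continuous γ
  injective : Function.Injective γ
  zero : γ 0 = v
  one : γ 1 = x
  spanning : ∀ t, spanningContinuum v (γ t) = γ '' Icc 0 t

namespace IsSpanningPath

variable {v x : X} {γ : unitInterval → X}

theorem range_eq (h : IsSpanningPath v x γ) : range γ = spanningContinuum v x := by
  rw [← h.one, h.spanning, ← image_univ]
  congr 1
  ext t
  simp [unitInterval.le_one']

theorem mem_iff (h : IsSpanningPath v x γ) {s t : unitInterval} :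
    γ s ∈ spanningContinuum v (γ t) ↔ s ≤ t := by
  rw [h.spanning, h.injective.mem_set_image]
  simp

theorem exists_eq (h : IsSpanningPath v x γ) {y : X} (hy : y ∈ spanningContinuum v x) :
    ∃ t, γ t = y := by
  rwa [← h.range_eq] at hy

theorem isSubcontinuum (h : IsSpanningPath v x γ) : IsSubcontinuum (spanningContinuum v x) := by
  rw [← h.range_eq]
  exact ⟨isCompact_range h.continuous, isConnected_range h.continuous⟩

end IsSpanningPath

namespace IsDendroid

theorem exists_isSpanningPath [T2Space X] (hX : IsDendroid (univ : Set X)) {v x : X}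
    (hx : v ≠ x) : ∃ γ, IsSpanningPath v x γ := by
  obtain ⟨A, -, -, hAv, hAx⟩ := hX.2.1 v (mem_univ v) x (mem_univ x) hx
  obtain ⟨φ, h0, h1⟩ := exists_parametrization hx hAv hAx
  have hc : Continuous fun t => (φ t : X) := continuous_subtype_val.comp φ.continuous
  have hi : Function.Injective fun t => (φ t : X) := Subtype.val_injective.comp φ.injective
  refine ⟨fun t => φ t, hc, hi, h0, h1, fun t => subset_antisymm ?_ ?_⟩
  · refine sInter_subset_of_mem ⟨⟨isCompact_Icc.image hc, ?_⟩, ⟨0, by simp, h0⟩,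
      ⟨t, by simp, rfl⟩⟩
    exact (isConnected_Icc unitInterval.nonneg').image _ hc.continuousOn
  · rintro _ ⟨s, hs, rfl⟩ K ⟨hK, hvK, htK⟩
    have hcon := hX.isConnected_inter hK
      ⟨isCompact_range hc, isConnected_range hc⟩ ⟨v, hvK, 0, h0⟩
    rw [← image_preimage_eq_inter_range,
      IsConnected, (hc.isClosedEmbedding hi).isInducing.isPreconnected_image] at hcon
    exact hcon.2.Icc_subset (by rwa [mem_preimage, h0]) htK hs

variable [T2Space X] (hX : IsDendroid (univ : Set X)) (v : X)

include hX

theorem isSubcontinuum_spanning (x : X) : IsSubcontinuum (spanningContinuum v x) := by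
  by_cases hx : v = x
  · rw [← hx, spanningContinuum_self]
    exact ⟨isCompact_singleton, isConnected_singleton⟩
  · obtain ⟨γ, hγ⟩ := hX.exists_isSpanningPath hx
    exact hγ.isSubcontinuum

theorem isArcFromTo_spanning (x : X) : IsArcFromTo (spanningContinuum v x) v x := by
  by_cases hx : v = x
  · rw [← hx, spanningContinuum_self]
    exact Or.inl ⟨rfl, rfl⟩
  · obtain ⟨γ, hγ⟩ := hX.exists_isSpanningPath hx
    have := isArcFromTo_range hγ.continuous hγ.injective
    rwa [hγ.zero, hγ.one, hγ.range_eq] at this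

theorem isPreconnected_upper (x : X) {U : Set X} (hU : U ⊆ spanningContinuum v x)
    (hup : ∀ y ∈ U, ∀ z ∈ spanningContinuum v x, y ∈ spanningContinuum v z → z ∈ U) :
    IsPreconnected U := by
  by_cases hx : v = x
  · rw [← hx, spanningContinuum_self] at hU
    exact (subsingleton_singleton.anti hU).isPreconnected
  · obtain ⟨γ, hγ⟩ := hX.exists_isSpanningPath hx
    have hup' : IsUpperSet (γ ⁻¹' U) := fun s t hst hs =>
      hup _ hs _ (hγ.range_eq ▸ mem_range_self t) (hγ.mem_iff.2 hst)
    have := hup'.ordConnected.isPreconnected.image γ hγ.continuous.continuousOn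
    rwa [image_preimage_eq_of_subset (hγ.range_eq ▸ hU)] at this

theorem spanning_antisymm {x y : X} (hx : x ∈ spanningContinuum v y)
    (hy : y ∈ spanningContinuum v x) : x = y := by
  by_cases hyv : v = y
  · rw [← hyv, spanningContinuum_self] at hx
    rw [← hyv, mem_singleton_iff.1 hx]
  · obtain ⟨γ, hγ⟩ := hX.exists_isSpanningPath hyv
    obtain ⟨s, rfl⟩ := hγ.exists_eq hx
    rw [← hγ.one, hγ.mem_iff] at hy
    rw [← hγ.one, le_antisymm unitInterval.le_one' hy]

end IsDendroid

/-- Two paths that branch at an interior point of both form a simple triod. -/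
theorem exists_isSimpleTriodWithTop [T2Space X] {γ δ : unitInterval → X} (hγ : Continuous γ)
    (hγi : Function.Injective γ) (hδ : Continuous δ) (hδi : Function.Injective δ)
    {s t : unitInterval} (hs0 : 0 < s) (hs1 : s < 1) (ht1 : t < 1) (hst : γ s = δ t)
    (hne : ∀ u w, t < w → γ u ≠ δ w) : ∃ T, IsSimpleTriodWithTop T (γ s) := by
  have hs0' : (0 : ℝ) < s := hs0
  have hs1' : (s : ℝ) < 1 := hs1
  have ht1' : (t : ℝ) < 1 := ht1
  set ε : ℝ := min (s : ℝ) (1 - s) with hε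
  have hε0 : 0 < ε := lt_min hs0' (by linarith)
  have hεs : ε ≤ s := min_le_left _ _
  have hεs' : ε ≤ 1 - s := min_le_right _ _
  let P : ℝ → unitInterval := projIcc 0 1 zero_le_one
  have hP : ∀ r ∈ Icc (0 : ℝ) 1, (P r : ℝ) = r := fun r hr => by
    rw [show P r = ⟨r, hr⟩ from projIcc_of_mem _ hr]
  have hPs : P s = s := projIcc_val zero_le_one s
  have hPt : P t = t := projIcc_val zero_le_one t
  let g : ℝ × ℝ → X := fun p => γ (P (s + p.1 * ε))
  let d : ℝ × ℝ → X := fun p => δ (P (t + p.2 * (1 - t)))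
  have hg : Continuous g := hγ.comp (continuous_projIcc.comp (by fun_prop))
  have hd : Continuous d := hδ.comp (continuous_projIcc.comp (by fun_prop))
  let h : ℝ × ℝ → X := fun p => if p.2 = 0 then g p else d p
  have hcont : ContinuousOn h triodModel := by
    refine ContinuousOn.union_of_isClosed ?_ ?_ (isClosed_Icc.prod isClosed_singleton)
      (isClosed_singleton.prod isClosed_Icc)
    · exact hg.continuousOn.congr fun p hp => if_pos hp.2
    · refine hd.continuousOn.congr fun p hp => ?_
      have hp1 : p.1 = 0 := hp.1
      change ite _ _ _ = _
      split_ifs with hp2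
      · simp [g, d, hp1, hp2, hPs, hPt, hst]
      · rfl
  have hgm : ∀ p ∈ triodModel, p.2 = 0 → (P (s + p.1 * ε) : ℝ) = s + p.1 * ε := by
    intro p hp hp2
    refine hP _ ?_
    have : p.1 ∈ Icc (-1 : ℝ) 1 := by
      rcases hp with hp | hp
      · exact hp.1
      · rw [mem_singleton_iff.1 hp.1]
        norm_num
    constructor <;> nlinarith [this.1, this.2]
  have hdm : ∀ p ∈ triodModel, p.2 ≠ 0 →
      p.1 = 0 ∧ 0 < p.2 ∧ (P (t + p.2 * (1 - t)) : ℝ) = t + p.2 * (1 - t) := by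
    intro p hp hp2
    rcases hp with hp | hp
    · exact absurd hp.2 hp2
    · refine ⟨hp.1, hp.2.1.lt_of_ne (Ne.symm hp2), hP _ ?_⟩
      have := t.2.1
      constructor <;> nlinarith [hp.2.1, hp.2.2]
  have hgd : ∀ p ∈ triodModel, ∀ q ∈ triodModel, p.2 = 0 → q.2 ≠ 0 → g p ≠ d q := by
    intro p _ q hq _ hq2
    obtain ⟨-, hq0, hq⟩ := hdm q hq hq2
    refine hne _ _ (Subtype.coe_lt_coe.1 ?_)
    rw [hq]
    nlinarith
  have hinj : InjOn h triodModel := by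
    intro p hp q hq hpq
    change ite _ _ _ = ite _ _ _ at hpq
    split_ifs at hpq with hp2 hq2 hq2
    · have := congrArg Subtype.val (hγi hpq)
      rw [hgm p hp hp2, hgm q hq hq2] at this
      exact Prod.ext (mul_right_cancel₀ hε0.ne' (add_left_cancel this)) (hp2.trans hq2.symm)
    · exact absurd hpq (hgd p hp q hq hp2 hq2)
    · exact absurd hpq.symm (hgd q hq p hp hq2 hp2)
    · obtain ⟨hp1, -, hp'⟩ := hdm p hp hp2
      obtain ⟨hq1, -, hq'⟩ := hdm q hq hq2
      have := congrArg Subtype.val (hδi hpq)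
      rw [hp', hq'] at this
      exact Prod.ext (hp1.trans hq1.symm)
        (mul_right_cancel₀ (sub_pos.2 ht1').ne' (add_left_cancel this))
  have : CompactSpace triodModel := isCompact_iff_compactSpace.1
    ((isCompact_Icc.prod isCompact_singleton).union (isCompact_singleton.prod isCompact_Icc))
  refine ⟨_, (hcont.domRestrict.isClosedEmbedding hinj.injective).isEmbedding.toHomeomorph, ?_⟩
  change h (0, 0) = γ s
  simp [h, g, hPs]

theorem IsFan.inter_spanning [T2Space X] (hX : IsFan (univ : Set X)) {v : X}
    (hv : IsRamificationPoint univ v) {x y : X} (hxy : x ∉ spanningContinuum v y)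
    (hyx : y ∉ spanningContinuum v x) :
    spanningContinuum v x ∩ spanningContinuum v y = {v} := by
  have hxv : v ≠ x := fun e => hxy (e ▸ top_mem_spanningContinuum v y)
  have hyv : v ≠ y := fun e => hyx (e ▸ top_mem_spanningContinuum v x)
  obtain ⟨γ, hγ⟩ := hX.1.exists_isSpanningPath hxv
  obtain ⟨δ, hδ⟩ := hX.1.exists_isSpanningPath hyv
  have hcl : IsClosed (γ ⁻¹' spanningContinuum v y) :=
    hδ.isSubcontinuum.1.isClosed.preimage hγ.continuous
  obtain ⟨s, hs, hmax⟩ := hcl.isCompact.exists_isGreatest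
    ⟨0, by simp [hγ.zero, top_mem_spanningContinuum]⟩
  obtain ⟨t, ht⟩ := hδ.exists_eq hs
  have hs0 : s = 0 := by
    by_contra hs0
    have hs1 : s ≠ 1 := fun e => hxy (by rwa [e, mem_preimage, hγ.one] at hs)
    have ht1 : t ≠ 1 := fun e => hyx (by
      rw [← hδ.one, ← e, ht, ← hγ.range_eq]
      exact mem_range_self s)
    obtain ⟨T, hT⟩ := exists_isSimpleTriodWithTop hγ.continuous hγ.injective hδ.continuous
      hδ.injective (unitInterval.pos_iff_ne_zero.2 hs0) (unitInterval.lt_one_iff_ne_one.2 hs1)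
      (unitInterval.lt_one_iff_ne_one.2 ht1) ht.symm fun u w hw e => by
        have hu : γ u ∈ spanningContinuum v y := e ▸ hδ.range_eq ▸ mem_range_self w
        have := hγ.mem_iff.2 (hmax hu)
        rw [e, ← ht, hδ.mem_iff] at this
        exact hw.not_ge this
    have := hX.2 _ v ⟨mem_univ _, T, subset_univ _, hT⟩ hv
    exact hs0 (hγ.injective (this.trans hγ.zero.symm))
  refine subset_antisymm ?_ (singleton_subset_iff.2
    ⟨top_mem_spanningContinuum v x, top_mem_spanningContinuum v y⟩)
  rintro z ⟨hz, hzy⟩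
  obtain ⟨u, rfl⟩ := hγ.exists_eq hz
  rw [le_antisymm ((hmax hzy).trans_eq hs0) unitInterval.nonneg', hγ.zero]
  rfl

theorem IsFan.spanning_chain [T2Space X] (hX : IsFan (univ : Set X)) {v : X}
    (hv : IsRamificationPoint univ v) {K : Set X} (hK : IsCompact K) (hKc : IsPreconnected K)
    (hvK : v ∉ K) {x y : X} (hx : x ∈ K) (hy : y ∈ K) :
    x ∈ spanningContinuum v y ∨ y ∈ spanningContinuum v x := by
  by_contra! hxy
  have hJ := hX.1.isSubcontinuum_spanning v
  have hM : IsSubcontinuum (spanningContinuum v x ∪ spanningContinuum v y) :=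
    ⟨(hJ x).1.union (hJ y).1, IsConnected.union
      ⟨v, top_mem_spanningContinuum v x, top_mem_spanningContinuum v y⟩ (hJ x).2 (hJ y).2⟩
  have hxm := mem_spanningContinuum v x
  have hym := mem_spanningContinuum v y
  have hcon := (hX.1.isConnected_inter ⟨hK, ⟨x, hx⟩, hKc⟩ hM ⟨x, hx, Or.inl hxm⟩).isPreconnected
  obtain ⟨z, ⟨hzK, -⟩, hz⟩ := isPreconnected_closed_iff.1 hcon _ _ (hJ x).1.isClosed
    (hJ y).1.isClosed inter_subset_right ⟨x, ⟨hx, Or.inl hxm⟩, hxm⟩ ⟨y, ⟨hy, Or.inr hym⟩, hym⟩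
  rw [hX.inter_spanning hv hxy.1 hxy.2] at hz
  exact hvK (mem_singleton_iff.1 hz ▸ hzK)

theorem IsLelekFan.isLegSystem {L : Type*} [MetricSpace L] {v : L}
    (hL : IsLelekFan (univ : Set L) v) : IsLegSystem v (spanningContinuum v) where
  self_mem := mem_spanningContinuum v
  top_mem := top_mem_spanningContinuum v
  isCompact x := (hL.1.1.1.1.isSubcontinuum_spanning v x).1
  isPreconnected_upper x _ := hL.1.1.1.1.isPreconnected_upper v x
  subset _ _ := spanningContinuum_subset
  antisymm _ _ := hL.1.1.1.1.spanning_antisymm v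
  chain _ hK hKc hvK _ hx _ hy := hL.1.1.1.spanning_chain hL.1.1.2 hK hKc hvK hx hy
  tendsto xs x hxs := hL.1.2 x (mem_univ x) xs (fun _ => mem_univ _) hxs _ (subset_univ _)
    (hL.1.1.1.1.isArcFromTo_spanning v x) _
    fun n => ⟨subset_univ _, hL.1.1.1.1.isArcFromTo_spanning v (xs n)⟩
  exists_endpoint x U hU := by
    obtain ⟨e, heU, he⟩ := mem_closure_iff_nhds.1 (hL.2 (mem_univ x)) U hU
    refine ⟨e, heU, fun y hev hey => ?_⟩
    rcases hL.1.1.1.1.isArcFromTo_spanning v y with ⟨hvy, h⟩ | ⟨hvy, harc, h0, h1⟩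
    · rw [h] at hey
      exact absurd hey hev
    · obtain ⟨φ, hφ0, hφ1⟩ := exists_parametrization hvy h0 h1
      rcases isEndpointOfArc_eq φ (he.2 _ (subset_univ _) harc hey) with h | h
      · exact absurd (h.trans hφ0) hev
      · exact h.trans hφ1

theorem IsRamificationPoint.exists_ne {K : Set X} {v : X} (hv : IsRamificationPoint K v) :
    ∃ x, x ≠ v := by
  obtain ⟨-, T, -, φ, rfl⟩ := hv
  refine ⟨φ ⟨(1, 0), Or.inl ⟨by norm_num, rfl⟩⟩, fun e => ?_⟩
  have := congrArg Subtype.val (φ.injective (Subtype.ext e))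
  simp at this

end Dendroids

/-- there is a non-surjective embedding of the Lelek fan `L` into
itself that admits a retraction of `L` onto its image. -/
theorem stmt8 {L : Type*} [MetricSpace L] (v : L)
    (hL : IsLelekFan (Set.univ : Set L) v) :
    ∃ f : L → L, Topology.IsEmbedding f ∧ ¬ Function.Surjective f ∧
      ∃ r : L → L, Continuous r ∧ (∀ x, r x ∈ Set.range f) ∧
        ∀ x ∈ Set.range f, r x = x := by
  have : CompactSpace L := isCompact_univ_iff.1 hL.1.1.1.1.1.1
  obtain ⟨x₀, hx₀⟩ := hL.1.1.2.exists_ne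
  exact hL.isLegSystem.exists_retract hx₀
end

section
/- Let L be a Lelek fan and C a Cantor fan. There exists an embedding f : L → L such that f does not admit a retraction from L onto f(L). In fact, if f factors as f = e ∘ g where g : L → C and e : C → L are embeddings, then no retraction from L onto f(L) exists. -/
open Set Topology Filter

section PlaneTriods

lemma isCompact_triodModel : IsCompact triodModel :=
  (isCompact_Icc.prod isCompact_singleton).union (isCompact_singleton.prod isCompact_Icc)

lemma isRamificationPoint_of_continuous_injective {X : Type*} [TopologicalSpace X] [T2Space X]
    (f : triodModel → X) (hf : Continuous f) (hinj : Function.Injective f) :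
    IsRamificationPoint univ (f ⟨(0, 0), triod_top_mem⟩) := by
  have : CompactSpace triodModel := isCompact_iff_compactSpace.1 isCompact_triodModel
  exact ⟨mem_univ _, range f, subset_univ _,
    (hf.isClosedEmbedding hinj).isEmbedding.toHomeomorph, rfl⟩

lemma IsRamificationPoint.map {X Y : Type*} [TopologicalSpace X] [TopologicalSpace Y] [T2Space Y]
    {x : X} (hx : IsRamificationPoint univ x) {F : X → Y} (hF : Continuous F)
    (hinj : Function.Injective F) : IsRamificationPoint univ (F x) := by
  obtain ⟨-, T, -, φ, rfl⟩ := hx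
  exact isRamificationPoint_of_continuous_injective (fun p => F (φ p))
    (hF.comp (continuous_subtype_val.comp φ.continuous))
    (hinj.comp (Subtype.val_injective.comp φ.injective))

lemma isRamificationPoint_of_paths {X : Type*} [TopologicalSpace X] [T2Space X] {γ β : ℝ → X}
    (hγ : Continuous γ) (hβ : Continuous β) (hγi : InjOn γ (Icc (-1) 1))
    (hβi : InjOn β (Icc 0 1)) (h0 : γ 0 = β 0)
    (hdisj : ∀ a ∈ Icc (-1 : ℝ) 1, ∀ b ∈ Icc (0 : ℝ) 1, γ a = β b → b = 0) :
    IsRamificationPoint univ (γ 0) := by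
  let F : ℝ × ℝ → X := fun p => if p.2 ≤ 0 then γ p.1 else β p.2
  have hF : ContinuousOn F triodModel := by
    apply ContinuousOn.union_of_isClosed
    · apply (hγ.comp continuous_fst).continuousOn.congr
      rintro ⟨a, b⟩ ⟨-, rfl⟩
      simp [F]
    · apply (hβ.comp continuous_snd).continuousOn.congr
      rintro ⟨a, b⟩ ⟨ha, hb⟩
      simp only [mem_singleton_iff, mem_Icc] at ha hb
      rcases hb.1.eq_or_lt with h | h
      · simp [F, ha, ← h, h0]
      · simp [F, h.not_ge]
    · exact isClosed_Icc.prod isClosed_singleton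
    · exact isClosed_singleton.prod isClosed_Icc
  have hinj : InjOn F triodModel := by
    have key : ∀ p ∈ triodModel, (p.2 = 0 ∧ p.1 ∈ Icc (-1 : ℝ) 1 ∧ F p = γ p.1) ∨
        (p.1 = 0 ∧ 0 < p.2 ∧ p.2 ∈ Icc (0 : ℝ) 1 ∧ F p = β p.2) := by
      rintro ⟨a, b⟩ (⟨ha, hb⟩ | ⟨ha, hb⟩)
      · simp only [mem_singleton_iff] at ha hb
        exact Or.inl ⟨hb, ha, by simp [F, hb]⟩
      · simp only [mem_singleton_iff] at ha hb
        rcases hb.1.eq_or_lt with h | h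
        · exact Or.inl ⟨h.symm, by simp [ha], by simp [F, ← h]⟩
        · exact Or.inr ⟨ha, h, hb, by simp [F, h.not_ge]⟩
    intro p hp q hq hpq
    rcases key p hp with ⟨h1, h2, h3⟩ | ⟨h1, h2, h3, h4⟩ <;>
      rcases key q hq with ⟨k1, k2, k3⟩ | ⟨k1, k2, k3, k4⟩
    · exact Prod.ext (hγi h2 k2 (by rw [← h3, ← k3, hpq])) (by rw [h1, k1])
    · exact absurd (hdisj _ h2 _ k3 (by rw [← h3, ← k4, hpq])) k2.ne'
    · exact absurd (hdisj _ k2 _ h3 (by rw [← h4, ← k3, hpq])) h2.ne'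
    · exact Prod.ext (by rw [h1, k1]) (hβi h3 k3 (by rw [← h4, ← k4, hpq]))
  have := isRamificationPoint_of_continuous_injective (triodModel.domRestrict F)
    (continuousOn_iff_continuous_domRestrict.1 hF) hinj.injective
  simpa [F, Set.domRestrict_apply] using this

end PlaneTriods

section Arcs
variable {X : Type*} [TopologicalSpace X]

lemma isEndpointOfArc_image [T2Space X] {γ : ℝ → X} (hγ : ContinuousOn γ (Icc 0 1))
    (hinj : InjOn γ (Icc 0 1)) :
    IsArc (γ '' Icc 0 1) ∧ IsEndpointOfArc (γ '' Icc 0 1) (γ 0) := by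
  rw [← range_domRestrict]
  let e := ((continuousOn_iff_continuous_domRestrict.1 hγ).isClosedEmbedding
    hinj.injective).isEmbedding.toHomeomorph
  exact ⟨⟨e.symm⟩, e, rfl⟩

lemma isArcFromTo_image [T2Space X] {γ : ℝ → X} {s : ℝ} (hs : 0 ≤ s)
    (hγ : ContinuousOn γ (Icc 0 s)) (hinj : InjOn γ (Icc 0 s)) :
    IsArcFromTo (γ '' Icc 0 s) (γ 0) (γ s) := by
  rcases hs.eq_or_lt with rfl | hs
  · exact Or.inl ⟨rfl, by simp⟩
  · have m1 : MapsTo (fun t => s * t) (Icc (0 : ℝ) 1) (Icc 0 s) := fun t ht =>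
      ⟨mul_nonneg hs.le ht.1, mul_le_of_le_one_right hs.le ht.2⟩
    have m2 : MapsTo (fun t => s * (1 - t)) (Icc (0 : ℝ) 1) (Icc 0 s) := fun t ht =>
      m1 ⟨sub_nonneg.2 ht.2, sub_le_self _ ht.1⟩
    have s1 : (fun t => γ (s * t)) '' Icc (0 : ℝ) 1 = γ '' Icc 0 s := by
      rw [← image_image γ (fun t => s * t)]
      congr 1
      refine m1.image_subset.antisymm fun u hu => ⟨u / s, ⟨div_nonneg hu.1 hs.le, ?_⟩, ?_⟩
      · exact (div_le_one hs).2 hu.2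
      · exact mul_div_cancel₀ _ hs.ne'
    have s2 : (fun t => γ (s * (1 - t))) '' Icc (0 : ℝ) 1 = γ '' Icc 0 s := by
      rw [← s1]
      ext y
      constructor
      · rintro ⟨t, ht, rfl⟩
        exact ⟨1 - t, ⟨sub_nonneg.2 ht.2, sub_le_self _ ht.1⟩, rfl⟩
      · rintro ⟨t, ht, rfl⟩
        exact ⟨1 - t, ⟨sub_nonneg.2 ht.2, sub_le_self _ ht.1⟩, by simp⟩
    have a1 := isEndpointOfArc_image (γ := fun t => γ (s * t))
      (hγ.comp (by fun_prop) m1)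
      (hinj.comp (fun a _ b _ h => mul_left_cancel₀ hs.ne' h) m1)
    have a2 := isEndpointOfArc_image (γ := fun t => γ (s * (1 - t)))
      (hγ.comp (by fun_prop) m2)
      (hinj.comp (fun a _ b _ h => by
        have := mul_left_cancel₀ hs.ne' h
        linarith) m2)
    rw [s1] at a1
    rw [s2] at a2
    simp only [mul_zero, sub_zero, mul_one] at a1 a2
    refine Or.inr ⟨fun h => ?_, a1.1, a1.2, a2.2⟩
    exact hs.ne (hinj ⟨le_rfl, hs.le⟩ ⟨hs.le, le_rfl⟩ h)

/-- An endpoint of an arc is one of the two ends of any parametrization. -/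
lemma IsEndpointOfArc.eq_zero_or_one {A : Set X} {x : X} (hx : IsEndpointOfArc A x)
    (φ : Icc (0 : ℝ) 1 ≃ₜ A) {t : Icc (0 : ℝ) 1} (ht : (φ t : X) = x) :
    (t : ℝ) = 0 ∨ (t : ℝ) = 1 := by
  obtain ⟨ψ, hψ⟩ := hx
  let χ : Icc (0 : ℝ) 1 ≃ₜ Icc (0 : ℝ) 1 := ψ.trans φ.symm
  have hχ : χ ⟨0, by norm_num⟩ = t := by
    simp only [χ, Homeomorph.trans_apply]
    rw [Homeomorph.symm_apply_eq]
    exact Subtype.ext (hψ.trans ht.symm)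
  have hpre : IsPreconnected (χ '' Ioi (⟨0, by norm_num⟩ : Icc (0 : ℝ) 1)) :=
    isPreconnected_Ioi.image _ χ.continuous.continuousOn
  have hmem : ∀ u, u ≠ t → u ∈ χ '' Ioi (⟨0, by norm_num⟩ : Icc (0 : ℝ) 1) := by
    intro u hu
    refine ⟨χ.symm u, lt_of_le_of_ne (χ.symm u).2.1 fun h => hu ?_, by simp⟩
    rw [← hχ, ← χ.apply_symm_apply u]
    exact congrArg χ (Subtype.ext h.symm)
  by_contra! h
  have h0 : (⟨0, by norm_num⟩ : Icc (0 : ℝ) 1) ≠ t := fun e => h.1 (by rw [← e])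
  have h1 : (⟨1, by norm_num⟩ : Icc (0 : ℝ) 1) ≠ t := fun e => h.2 (by rw [← e])
  obtain ⟨u, hu, hut⟩ := hpre.ordConnected.out (hmem _ h0) (hmem _ h1) (show t ∈ Icc _ _ from ⟨t.2.1, t.2.2⟩)
  exact (ne_of_gt hu) (χ.injective (hut.trans hχ.symm))

lemma IsArcFromTo.exists_path {A : Set X} {x y : X} (h : IsArcFromTo A x y) (hxy : x ≠ y) :
    ∃ γ : ℝ → X, Continuous γ ∧ InjOn γ (Icc 0 1) ∧ γ 0 = x ∧ γ 1 = y ∧ γ '' Icc 0 1 = A := by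
  obtain ⟨h, -⟩ | ⟨-, -, ⟨φ, hφ⟩, hy⟩ := h
  · exact absurd h hxy
  have hyA : y ∈ A := by
    obtain ⟨ψ, rfl⟩ := hy
    exact (ψ _).2
  obtain ⟨t, ht⟩ := φ.surjective ⟨y, hyA⟩
  have ht' : (φ t : X) = y := by rw [ht]
  have ht1 : (t : ℝ) = 1 := by
    refine (hy.eq_zero_or_one φ ht').resolve_left fun h0 => hxy ?_
    rw [← hφ, ← ht']
    congr 2
    exact Subtype.ext h0.symm
  let γ : ℝ → X := IccExtend zero_le_one fun t => (φ t : X)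
  have hγ : ∀ t (ht : t ∈ Icc (0 : ℝ) 1), γ t = φ ⟨t, ht⟩ := fun t ht => IccExtend_of_mem _ _ ht
  refine ⟨γ, (continuous_subtype_val.comp φ.continuous).Icc_extend', ?_, ?_, ?_, ?_⟩
  · intro a ha b hb hab
    rw [hγ a ha, hγ b hb] at hab
    simpa using φ.injective (Subtype.val_injective hab)
  · rw [hγ 0 (by norm_num), hφ]
  · rw [hγ 1 (by norm_num), ← ht']
    congr 2
    exact Subtype.ext ht1.symm
  · ext z
    constructor
    · rintro ⟨t, ht, rfl⟩
      rw [hγ t ht]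
      exact (φ _).2
    · intro hz
      obtain ⟨t, ht⟩ := φ.surjective ⟨z, hz⟩
      exact ⟨t, t.2, by rw [hγ t t.2, Subtype.coe_eta, ht]⟩

end Arcs

section SmoothFan
variable {L : Type*} [MetricSpace L] {v x y z : L}

/-- The arc from `v` to `x` (it is unique in a smooth fan with top `v`). -/
def leg (v x : L) : Set L := ⋃₀ {A | IsArcFromTo A v x}

lemma IsArcFromTo.isCompact {A : Set L} (h : IsArcFromTo A x y) : IsCompact A := by
  obtain ⟨-, rfl⟩ | ⟨-, ⟨φ⟩, -⟩ := h
  · exact isCompact_singleton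
  · exact isCompact_iff_compactSpace.2 φ.symm.compactSpace

lemma IsArcFromTo.left_mem {A : Set L} (h : IsArcFromTo A x y) : x ∈ A := by
  obtain ⟨-, rfl⟩ | ⟨-, -, ⟨φ, rfl⟩, -⟩ := h
  · rfl
  · exact (φ _).2

namespace IsSmoothFan

lemma compactSpace (hL : IsSmoothFan (univ : Set L) v) : CompactSpace L :=
  isCompact_univ_iff.1 hL.1.1.1.1.1

lemma leg_eq (hL : IsSmoothFan (univ : Set L) v) {A : Set L} (hA : IsArcFromTo A v x) :
    leg v x = A := by
  have key : ∀ B, IsArcFromTo B v x → B = A := by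
    intro B hB
    have := hL.2 x (mem_univ _) (fun _ => x) (fun _ => mem_univ _) tendsto_const_nhds A
      (subset_univ _) hA (fun _ => B) (fun _ => ⟨subset_univ _, hB⟩)
    have h0 := tendsto_nhds_unique this tendsto_const_nhds
    exact (hB.isCompact.isClosed.hausdorffDist_zero_iff_eq hA.isCompact.isClosed
      (Metric.hausdorffEDist_ne_top_of_nonempty_of_bounded ⟨_, hB.left_mem⟩ ⟨_, hA.left_mem⟩
        hB.isCompact.isBounded hA.isCompact.isBounded)).1 h0.symm
  exact (sUnion_subset fun B hB => (key B hB).subset).antisymm (subset_sUnion_of_mem hA)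

lemma leg_eq_image (hL : IsSmoothFan (univ : Set L) v) {γ : ℝ → L} {s : ℝ} (hs : 0 ≤ s)
    (hγ : ContinuousOn γ (Icc 0 s)) (hinj : InjOn γ (Icc 0 s)) (h0 : γ 0 = v) :
    leg v (γ s) = γ '' Icc 0 s :=
  hL.leg_eq (h0 ▸ isArcFromTo_image hs hγ hinj)

lemma leg_top (hL : IsSmoothFan (univ : Set L) v) : leg v v = {v} :=
  hL.leg_eq (Or.inl ⟨rfl, rfl⟩)

lemma exists_param (hL : IsSmoothFan (univ : Set L) v) (x : L) :
    ∃ γ : ℝ → L, Continuous γ ∧ (x ≠ v → InjOn γ (Icc 0 1)) ∧ γ 0 = v ∧ γ 1 = x ∧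
      ∀ t ∈ Icc (0 : ℝ) 1, leg v (γ t) = γ '' Icc 0 t := by
  by_cases hx : x = v
  · subst hx
    refine ⟨fun _ => x, continuous_const, fun h => absurd rfl h, rfl, rfl, fun t ht => ?_⟩
    rw [hL.leg_top, (nonempty_Icc.2 ht.1).image_const]
  · obtain ⟨A, -, hA⟩ := hL.1.1.1.2.1 v (mem_univ _) x (mem_univ _) (Ne.symm hx)
    obtain ⟨γ, hγ, hi, h0, h1, -⟩ :=
      IsArcFromTo.exists_path (A := A) (Or.inr ⟨Ne.symm hx, hA⟩) (Ne.symm hx)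
    refine ⟨γ, hγ, fun _ => hi, h0, h1, fun t ht => ?_⟩
    exact hL.leg_eq_image ht.1 hγ.continuousOn (hi.mono (Icc_subset_Icc_right ht.2)) h0

lemma isArcFromTo_leg (hL : IsSmoothFan (univ : Set L) v) (x : L) :
    IsArcFromTo (leg v x) v x := by
  by_cases hx : x = v
  · subst hx
    exact Or.inl ⟨rfl, hL.leg_top⟩
  · obtain ⟨A, -, hA⟩ := hL.1.1.1.2.1 v (mem_univ _) x (mem_univ _) (Ne.symm hx)
    have h : IsArcFromTo A v x := Or.inr ⟨Ne.symm hx, hA⟩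
    rwa [hL.leg_eq h]

lemma top_mem_leg (hL : IsSmoothFan (univ : Set L) v) (x : L) : v ∈ leg v x :=
  (hL.isArcFromTo_leg x).left_mem

lemma isCompact_leg (hL : IsSmoothFan (univ : Set L) v) (x : L) : IsCompact (leg v x) :=
  (hL.isArcFromTo_leg x).isCompact

lemma self_mem_leg (hL : IsSmoothFan (univ : Set L) v) (x : L) : x ∈ leg v x := by
  obtain ⟨γ, -, -, -, rfl, h⟩ := hL.exists_param x
  rw [h 1 ⟨zero_le_one, le_rfl⟩]
  exact ⟨1, ⟨zero_le_one, le_rfl⟩, rfl⟩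

lemma isPreconnected_leg (hL : IsSmoothFan (univ : Set L) v) (x : L) :
    IsPreconnected (leg v x) := by
  obtain ⟨γ, hγ, -, -, rfl, h⟩ := hL.exists_param x
  rw [h 1 ⟨zero_le_one, le_rfl⟩]
  exact isPreconnected_Icc.image _ hγ.continuousOn

lemma leg_subset (hL : IsSmoothFan (univ : Set L) v) (h : y ∈ leg v x) :
    leg v y ⊆ leg v x := by
  obtain ⟨γ, -, -, -, rfl, hp⟩ := hL.exists_param x
  rw [hp 1 ⟨zero_le_one, le_rfl⟩] at h ⊢
  obtain ⟨t, ht, rfl⟩ := h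
  rw [hp t ht]
  exact image_mono (Icc_subset_Icc_right ht.2)

lemma leg_antisymm (hL : IsSmoothFan (univ : Set L) v) (h : y ∈ leg v x) (h' : x ∈ leg v y) :
    x = y := by
  by_cases hx : x = v
  · subst hx
    rw [hL.leg_top] at h
    exact h.symm
  obtain ⟨γ, -, hi, -, h1, hp⟩ := hL.exists_param x
  rw [← h1, hp 1 ⟨zero_le_one, le_rfl⟩] at h
  obtain ⟨t, ht, rfl⟩ := h
  rw [hp t ht, ← h1] at h'
  obtain ⟨s, hs, hst⟩ := h'
  have := hi hx ⟨hs.1, hs.2.trans ht.2⟩ ⟨zero_le_one, le_rfl⟩ hst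
  rw [← h1, show t = 1 from le_antisymm ht.2 (this ▸ hs.2)]

lemma leg_total (hL : IsSmoothFan (univ : Set L) v) (h : y ∈ leg v x) (h' : z ∈ leg v x) :
    y ∈ leg v z ∨ z ∈ leg v y := by
  obtain ⟨γ, -, -, -, rfl, hp⟩ := hL.exists_param x
  rw [hp 1 ⟨zero_le_one, le_rfl⟩] at h h'
  obtain ⟨t, ht, rfl⟩ := h
  obtain ⟨s, hs, rfl⟩ := h'
  rw [hp t ht, hp s hs]
  rcases le_total t s with hts | hts
  · exact Or.inl ⟨t, ⟨ht.1, hts⟩, rfl⟩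
  · exact Or.inr ⟨s, ⟨hs.1, hts⟩, rfl⟩

lemma isPreconnected_segment (hL : IsSmoothFan (univ : Set L) v) (h : y ∈ leg v x) :
    IsPreconnected {p | p ∈ leg v x ∧ y ∈ leg v p} := by
  obtain ⟨γ, hγ, -, -, rfl, hp⟩ := hL.exists_param x
  have hp1 := hp 1 ⟨zero_le_one, le_rfl⟩
  have : {p | p ∈ leg v (γ 1) ∧ y ∈ leg v p} = γ '' {t | t ∈ Icc (0 : ℝ) 1 ∧ y ∈ leg v (γ t)} := by
    ext p
    constructor
    · rintro ⟨h1, h2⟩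
      rw [hp1] at h1
      obtain ⟨t, ht, rfl⟩ := h1
      exact ⟨t, ⟨ht, h2⟩, rfl⟩
    · rintro ⟨t, ⟨ht, h2⟩, rfl⟩
      exact ⟨hp1 ▸ mem_image_of_mem γ ht, h2⟩
  rw [this]
  refine IsPreconnected.image (OrdConnected.isPreconnected ⟨?_⟩) _ hγ.continuousOn
  rintro a ⟨ha, ha'⟩ b ⟨hb, -⟩ c hc
  have hc' : c ∈ Icc (0 : ℝ) 1 := ⟨ha.1.trans hc.1, hc.2.trans hb.2⟩
  refine ⟨hc', ?_⟩
  rw [hp a ha] at ha'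
  rw [hp c hc']
  exact image_mono (Icc_subset_Icc_right hc.1) ha'

lemma continuous_infDist_leg (hL : IsSmoothFan (univ : Set L) v) (p : L) :
    Continuous fun x => Metric.infDist p (leg v x) := by
  refine continuous_iff_seqContinuous.2 fun xs x hx => ?_
  have hH := hL.2 x (mem_univ _) xs (fun _ => mem_univ _) hx _ (subset_univ _)
    (hL.isArcFromTo_leg x) _ fun n => ⟨subset_univ _, hL.isArcFromTo_leg (xs n)⟩
  have fin : ∀ a b, Metric.hausdorffEDist (leg v a) (leg v b) ≠ ⊤ := fun a b =>
    Metric.hausdorffEDist_ne_top_of_nonempty_of_bounded ⟨_, hL.top_mem_leg a⟩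
      ⟨_, hL.top_mem_leg b⟩ (hL.isCompact_leg a).isBounded (hL.isCompact_leg b).isBounded
  refine tendsto_iff_dist_tendsto_zero.2 (squeeze_zero (fun _ => dist_nonneg) (fun n => ?_) hH)
  have h1 := Metric.infDist_le_infDist_add_hausdorffDist (x := p) (fin (xs n) x)
  have h2 := Metric.infDist_le_infDist_add_hausdorffDist (x := p) (fin x (xs n))
  rw [Metric.hausdorffDist_comm] at h2
  rw [Function.comp_apply, Real.dist_eq, abs_le]
  constructor <;> linarith

lemma isClosed_mem_leg (hL : IsSmoothFan (univ : Set L) v) :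
    IsClosed {p : L × L | p.1 ∈ leg v p.2} := by
  refine IsSeqClosed.isClosed fun ps p hps hp => ?_
  have h1 : Tendsto (fun n => Metric.infDist p.1 (leg v (ps n).2)) atTop
      (𝓝 (Metric.infDist p.1 (leg v p.2))) :=
    ((hL.continuous_infDist_leg p.1).tendsto p.2).comp hp.snd_nhds
  have h2 : Tendsto (fun n => dist p.1 (ps n).1) atTop (𝓝 0) := by
    have := (tendsto_const_nhds (x := p.1)).dist hp.fst_nhds
    rwa [dist_self] at this
  have h3 : Metric.infDist p.1 (leg v p.2) ≤ 0 :=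
    le_of_tendsto_of_tendsto' h1 h2 fun n => Metric.infDist_le_dist_of_mem (hps n)
  exact ((hL.isCompact_leg _).isClosed.mem_iff_infDist_zero ⟨_, hL.top_mem_leg _⟩).2
    (h3.antisymm Metric.infDist_nonneg)

/-- In a fan, two arcs issuing from the top that share another point are nested. -/
lemma mem_leg_or_mem_leg (hL : IsSmoothFan (univ : Set L) v) {p : L} (hp : p ≠ v)
    (hx : p ∈ leg v x) (hy : p ∈ leg v y) : x ∈ leg v y ∨ y ∈ leg v x := by
  have hxv : x ≠ v := by
    rintro rfl
    rw [hL.leg_top] at hx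
    exact hp hx
  have hyv : y ≠ v := by
    rintro rfl
    rw [hL.leg_top] at hy
    exact hp hy
  obtain ⟨α, hα, hαi, α0, α1, hαl⟩ := hL.exists_param x
  obtain ⟨β, hβ, hβi, β0, β1, hβl⟩ := hL.exists_param y
  replace hαi := hαi hxv
  replace hβi := hβi hyv
  have one : (1 : ℝ) ∈ Icc (0 : ℝ) 1 := ⟨zero_le_one, le_rfl⟩
  have hlx : leg v x = α '' Icc 0 1 := by rw [← hαl 1 one, α1]
  have hly : leg v y = β '' Icc 0 1 := by rw [← hβl 1 one, β1]
  have hScl : IsCompact {t | t ∈ Icc (0 : ℝ) 1 ∧ α t ∈ leg v y} :=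
    isCompact_Icc.inter_right ((hL.isCompact_leg y).isClosed.preimage hα)
  obtain ⟨t, ⟨ht, hty⟩, hmax⟩ := hScl.exists_isGreatest
    ⟨0, ⟨le_rfl, zero_le_one⟩, by rw [α0]; exact hL.top_mem_leg y⟩
  have ht0 : 0 < t := by
    rw [hlx] at hx
    obtain ⟨s, hs, rfl⟩ := hx
    refine lt_of_lt_of_le (lt_of_le_of_ne hs.1 ?_) (hmax ⟨hs, hy⟩)
    rintro rfl
    exact hp α0
  rcases ht.2.eq_or_lt with rfl | ht1
  · exact Or.inl (α1 ▸ hty)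
  have hty' := hty
  rw [hly] at hty'
  obtain ⟨u, hu, hut⟩ := hty'
  rcases hu.2.eq_or_lt with rfl | hu1
  · right
    rw [← β1, hut, hlx]
    exact ⟨t, ht, rfl⟩
  exfalso
  have hlegs : α '' Icc 0 t = β '' Icc 0 u := by rw [← hαl t ht, ← hβl u hu, hut]
  set m := min t (1 - t) with hm
  have hm0 : 0 < m := lt_min ht0 (by linarith)
  have hmt : m ≤ t := min_le_left _ _
  have hmt' : m ≤ 1 - t := min_le_right _ _
  have mapα : MapsTo (fun a => t + a * m) (Icc (-1 : ℝ) 1) (Icc 0 1) := fun a ha =>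
    ⟨by nlinarith [ha.1, ha.2], by nlinarith [ha.1, ha.2]⟩
  have mapβ : MapsTo (fun b => u + b * (1 - u)) (Icc (0 : ℝ) 1) (Icc 0 1) := fun b hb =>
    ⟨by nlinarith [hb.1, hb.2, hu.1], by nlinarith [hb.1, hb.2]⟩
  have hram : IsRamificationPoint univ (α (t + 0 * m)) := by
    refine isRamificationPoint_of_paths (γ := fun a => α (t + a * m))
      (β := fun b => β (u + b * (1 - u))) (by fun_prop) (by fun_prop) ?_ ?_ (by simp [hut]) ?_
    · refine hαi.comp (fun a _ b _ h => ?_) mapα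
      exact mul_right_cancel₀ hm0.ne' (add_left_cancel h)
    · refine hβi.comp (fun a _ b _ h => ?_) mapβ
      exact mul_right_cancel₀ (by linarith : (1 - u) ≠ 0) (add_left_cancel h)
    · intro a ha b hb hab
      have hmem : α (t + a * m) ∈ leg v y := by
        rw [hly]
        exact ⟨_, mapβ hb, hab.symm⟩
      have hle := hmax ⟨mapα ha, hmem⟩
      have : β (u + b * (1 - u)) ∈ α '' Icc 0 t := ⟨_, ⟨(mapα ha).1, hle⟩, hab⟩
      rw [hlegs] at this
      obtain ⟨c, hc, hcb⟩ := this
      have := hβi ⟨hc.1, hc.2.trans hu.2⟩ (mapβ hb) hcb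
      have := hc.2
      nlinarith [hb.1]
  have hqv := hL.1.1.2 _ _ hram hL.1.2
  rw [zero_mul, add_zero, ← α0] at hqv
  exact ht0.ne' (hαi ht ⟨le_rfl, zero_le_one⟩ hqv)

lemma mem_leg_of_subcontinuum (hL : IsSmoothFan (univ : Set L) v) {S : Set L}
    (hS : IsSubcontinuum S) (hv : v ∉ S) (hx : x ∈ S) (hy : y ∈ S) :
    x ∈ leg v y ∨ y ∈ leg v x := by
  by_contra! hcon
  have hmeet : leg v x ∩ leg v y ⊆ {v} := by
    rintro p ⟨h1, h2⟩
    by_contra hp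
    rcases hL.mem_leg_or_mem_leg hp h1 h2 with h | h
    · exact hcon.1 h
    · exact hcon.2 h
  have legc : ∀ a, IsSubcontinuum (leg v a) := fun a =>
    ⟨hL.isCompact_leg a, ⟨v, hL.top_mem_leg a⟩, hL.isPreconnected_leg a⟩
  have hK : IsSubcontinuum (S ∪ leg v x) :=
    ⟨hS.1.union (legc x).1, hS.2.union ⟨x, hx, hL.self_mem_leg x⟩ (legc x).2⟩
  have hU : IsSubcontinuum (S ∪ leg v x ∪ leg v y) :=
    ⟨hK.1.union (legc y).1, hK.2.union ⟨y, Or.inl hy, hL.self_mem_leg y⟩ (legc y).2⟩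
  have hconn := (hL.1.1.1.2.2 _ (subset_univ _) hU _ _ hK (legc y) rfl).2
  have hcl := isPreconnected_closed_iff.1 hconn S {v} hS.1.isClosed isClosed_singleton ?_
    ⟨y, ⟨Or.inl hy, hL.self_mem_leg y⟩, hy⟩ ⟨v, ⟨Or.inr (hL.top_mem_leg x), hL.top_mem_leg y⟩, rfl⟩
  · obtain ⟨p, -, hpS, rfl⟩ := hcl
    exact hv hpS
  · rintro p ⟨h1 | h1, h2⟩
    · exact Or.inl h1
    · exact Or.inr (hmeet ⟨h1, h2⟩)

lemma eq_or_eq_top_of_isEndpoint (hL : IsSmoothFan (univ : Set L) v)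
    (hx : IsEndpoint (univ : Set L) x) (h : x ∈ leg v y) : x = y ∨ x = v := by
  rcases hL.isArcFromTo_leg y with ⟨-, hl⟩ | ⟨-, harc, ⟨φ, hφ⟩, hy⟩
  · rw [hl] at h
    exact Or.inr h
  · have hend := hx.2 _ (subset_univ _) harc h
    obtain ⟨t, ht⟩ := φ.surjective ⟨x, h⟩
    obtain ⟨s, hs⟩ := φ.surjective ⟨y, hL.self_mem_leg y⟩
    have ht' : (φ t : L) = x := by rw [ht]
    have hs' : (φ s : L) = y := by rw [hs]
    have zero : ∀ r : Icc (0 : ℝ) 1, (r : ℝ) = 0 → (φ r : L) = v := by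
      intro r hr
      rw [show r = ⟨0, by norm_num⟩ from Subtype.ext hr, hφ]
    rcases hend.eq_zero_or_one φ ht' with h0 | h1
    · exact Or.inr (ht' ▸ zero t h0)
    · rcases hy.eq_zero_or_one φ hs' with k0 | k1
      · rw [← hs', zero s k0, hL.leg_top] at h
        exact Or.inr h
      · left
        exact ht'.symm.trans ((congrArg (fun r => (φ r : L)) (Subtype.ext (h1.trans k1.symm))).trans hs')

/-- A self-embedding of a smooth fan fixes the top. -/
lemma apply_top (hL : IsSmoothFan (univ : Set L) v) {F : L → L} (hF : Continuous F)
    (hinj : Function.Injective F) : F v = v :=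
  hL.1.1.2 _ _ (hL.1.2.map hF hinj) hL.1.2

lemma image_leg (hL : IsSmoothFan (univ : Set L) v) {F : L → L} (hF : Continuous F)
    (hinj : Function.Injective F) (x : L) : F '' leg v x = leg v (F x) := by
  have hv := hL.apply_top hF hinj
  by_cases hx : x = v
  · subst hx
    rw [hv, hL.leg_top, image_singleton, hv]
  obtain ⟨γ, hγ, hi, h0, h1, hp⟩ := hL.exists_param x
  have one : (1 : ℝ) ∈ Icc (0 : ℝ) 1 := ⟨zero_le_one, le_rfl⟩
  have := hL.leg_eq_image (γ := F ∘ γ) zero_le_one (hF.comp hγ).continuousOn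
    (hinj.comp_injOn (hi hx)) (by simp [h0, hv])
  rw [← h1, hp 1 one, ← image_comp]
  exact this.symm

end IsSmoothFan

/-- The key obstruction: if each `F x` lies below `E x` and the gap is nontrivial at some point `w`
with `E w ∈ range F`, then `F` admits no retraction. -/
lemma IsLelekFan.not_exists_retraction (hLel : IsLelekFan (univ : Set L) v) {F E : L → L}
    (hF : Continuous F) (hinj : Function.Injective F) (hE : Continuous E)
    (hFE : ∀ x, F x ∈ leg v (E x)) {w : L} (hw : w ≠ v) (hwE : E w ∈ range F)
    (hwF : E w ∉ leg v (F w)) :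
    ¬ ∃ r : L → L, Continuous r ∧ (∀ x, r x ∈ range F) ∧ ∀ x ∈ range F, r x = x := by
  rintro ⟨r, hr, hrF, hrid⟩
  have hL := hLel.1
  have := hL.compactSpace
  have hFv := hL.apply_top hF hinj
  have hcl := hL.isClosed_mem_leg
  let seg : L → Set L := fun x => {p | p ∈ leg v (E x) ∧ F x ∈ leg v p}
  have hsegcl : IsClosed {q : L × L | q.2 ∈ seg q.1} :=
    (hcl.preimage (by fun_prop : Continuous fun q : L × L => (q.2, E q.1))).inter
      (hcl.preimage (by fun_prop : Continuous fun q : L × L => (F q.1, q.2)))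
  have hBcl : IsClosed (Prod.fst '' ({q : L × L | q.2 ∈ seg q.1} ∩ {q | r q.2 = v})) :=
    isClosedMap_fst_of_compactSpace _
      (hsegcl.inter (isClosed_eq (by fun_prop) continuous_const))
  have hCcl : IsClosed {x | r (E x) ∈ leg v (F x)} :=
    hcl.preimage (by fun_prop : Continuous fun x : L => (r (E x), F x))
  have hwB : w ∉ Prod.fst '' ({q : L × L | q.2 ∈ seg q.1} ∩ {q | r q.2 = v}) := by
    rintro ⟨⟨_, y⟩, ⟨⟨hy1, hy2⟩, hy3⟩, rfl⟩
    simp only at hy1 hy2 hy3 hw hwE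
    obtain ⟨u, hu⟩ := hwE
    rw [← hu, ← hL.image_leg hF hinj] at hy1
    obtain ⟨y', -, rfl⟩ := hy1
    rw [mem_ofPred_eq, hrid _ ⟨y', rfl⟩] at hy3
    rw [hy3, hL.leg_top, mem_singleton_iff, ← hFv] at hy2
    exact hw (hinj hy2)
  have hwC : w ∉ {x | r (E x) ∈ leg v (F x)} := by
    rw [mem_ofPred_eq, hrid _ hwE]
    exact hwF
  obtain ⟨x, ⟨hxB, hxC⟩, hxe⟩ := mem_closure_iff.1 (hLel.2 (mem_univ w)) _
    (hBcl.isOpen_compl.inter hCcl.isOpen_compl) ⟨hwB, hwC⟩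
  have hFseg : F x ∈ seg x := ⟨hFE x, hL.self_mem_leg _⟩
  have hEseg : E x ∈ seg x := ⟨hL.self_mem_leg _, hFE x⟩
  have hrFx : r (F x) = F x := hrid _ ⟨x, rfl⟩
  have hvS : v ∉ r '' seg x := by
    rintro ⟨y, hy, hyv⟩
    exact hxB ⟨(x, y), ⟨hy, hyv⟩, rfl⟩
  have hS : IsSubcontinuum (r '' seg x) :=
    ⟨((hsegcl.preimage (by fun_prop : Continuous fun y : L => (x, y))).isCompact).image hr,
      ⟨r (F x), mem_image_of_mem r hFseg⟩,
      (hL.isPreconnected_segment (hFE x)).image _ hr.continuousOn⟩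
  apply hxC
  rcases hL.mem_leg_of_subcontinuum hS hvS ⟨_, hEseg, rfl⟩ ⟨_, hFseg, hrFx⟩ with h | h
  · exact h
  · obtain ⟨u, hu⟩ := hrF (E x)
    rw [← hu, ← hL.image_leg hF hinj] at h
    obtain ⟨x', hx', hxx⟩ := h
    obtain rfl := hinj hxx
    rcases hL.eq_or_eq_top_of_isEndpoint hxe hx' with rfl | rfl
    · rw [mem_ofPred_eq, ← hu]
      exact hL.self_mem_leg _
    · rw [hFv] at hFseg hrFx
      exact absurd ⟨_, hFseg, hrFx⟩ hvS

namespace IsSmoothFan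

lemma exists_ne_top (hL : IsSmoothFan (univ : Set L) v) : ∃ x, x ≠ v := by
  obtain ⟨-, T, -, φ, hφ⟩ := hL.1.2
  refine ⟨φ ⟨(1, 0), Or.inl ⟨by norm_num, rfl⟩⟩, fun h => ?_⟩
  have := congrArg (fun p : triodModel => (p : ℝ × ℝ).1)
    (φ.injective (Subtype.val_injective (h.trans hφ.symm)))
  norm_num at this

/-- A smooth fan carries a continuous height function, strictly increasing along its legs. -/
lemma exists_height (hL : IsSmoothFan (univ : Set L) v) :
    ∃ h : L → ℝ, Continuous h ∧ h v = 0 ∧ ∀ x, ∀ y ∈ leg v x, y ≠ x → h y < h x := by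
  have := hL.compactSpace
  have : Nonempty L := ⟨v⟩
  let u := TopologicalSpace.denseSeq L
  let g : ℕ → L → ℝ := fun i x => (1 / 2 : ℝ) ^ i * Metric.infDist (u i) (leg v x)
  have hg0 : ∀ i x, 0 ≤ g i x := fun i x => mul_nonneg (by positivity) Metric.infDist_nonneg
  have hgle : ∀ i x, g i x ≤ (1 / 2 : ℝ) ^ i * Metric.diam (univ : Set L) := fun i x =>
    mul_le_mul_of_nonneg_left ((Metric.infDist_le_dist_of_mem (hL.top_mem_leg x)).trans
      (Metric.dist_le_diam_of_mem isCompact_univ.isBounded (mem_univ _) (mem_univ _)))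
      (by positivity)
  have hsum : Summable fun i : ℕ => (1 / 2 : ℝ) ^ i * Metric.diam (univ : Set L) :=
    summable_geometric_two.mul_right _
  have hH : Continuous fun x => ∑' i, g i x :=
    continuous_tsum (fun i => continuous_const.mul (hL.continuous_infDist_leg _)) hsum
      fun i x => by rw [Real.norm_of_nonneg (hg0 i x)]; exact hgle i x
  refine ⟨fun x => ∑' i, g i v - ∑' i, g i x, continuous_const.sub hH, sub_self _, ?_⟩
  intro x y hy hyx
  refine sub_lt_sub_left ?_ _
  have hx : x ∉ leg v y := fun h => hyx (hL.leg_antisymm hy h).symm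
  have hpos := ((hL.isCompact_leg y).isClosed.notMem_iff_infDist_pos ⟨_, hL.top_mem_leg y⟩).1 hx
  obtain ⟨i, hi⟩ := (TopologicalSpace.denseRange_denseSeq L).exists_dist_lt x (half_pos hpos)
  refine Summable.tsum_lt_tsum_of_nonneg (i := i) (fun j => hg0 j x) (fun j => ?_) ?_
    (hsum.of_nonneg_of_le (fun j => hg0 j y) fun j => hgle j y)
  · exact mul_le_mul_of_nonneg_left (Metric.infDist_le_infDist_of_subset (hL.leg_subset hy)
      ⟨_, hL.top_mem_leg y⟩) (by positivity)
  · refine mul_lt_mul_of_pos_left ?_ (by positivity)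
    have h1 : Metric.infDist (u i) (leg v x) ≤ dist (u i) x :=
      Metric.infDist_le_dist_of_mem (hL.self_mem_leg x)
    have h2 : Metric.infDist x (leg v y) ≤ Metric.infDist (u i) (leg v y) + dist x (u i) :=
      Metric.infDist_le_infDist_add_dist
    rw [dist_comm] at h1
    change dist x (u i) < _ at hi
    linarith

/-- A smooth fan can be shrunk into itself along its legs. -/
lemma exists_shrinking (hL : IsSmoothFan (univ : Set L) v) :
    ∃ f : L → L, Continuous f ∧ Function.Injective f ∧ (∀ x, f x ∈ leg v x) ∧
      ∀ x, x ≠ v → f x ≠ v ∧ x ∉ leg v (f x) := by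
  have := hL.compactSpace
  obtain ⟨h, hc, h0, hlt⟩ := hL.exists_height
  have hpos : ∀ x, x ≠ v → 0 < h x := fun x hx => by
    rw [← h0]
    exact hlt x v (hL.top_mem_leg x) hx.symm
  have hnn : ∀ x, 0 ≤ h x := fun x => by
    by_cases hx : x = v
    · rw [hx, h0]
    · exact (hpos x hx).le
  have hle : ∀ x, ∀ y ∈ leg v x, h y ≤ h x := fun x y hy => by
    by_cases hyx : y = x
    · rw [hyx]
    · exact (hlt x y hy hyx).le
  have huniq : ∀ x y, (x ∈ leg v y ∨ y ∈ leg v x) → h x = h y → x = y := by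
    intro x y hxy he
    by_contra hne
    rcases hxy with k | k
    · exact (hlt y x k hne).ne he
    · exact (hlt x y k (Ne.symm hne)).ne he.symm
  have hex : ∀ x, ∃ y ∈ leg v x, h y = h x / 2 := fun x =>
    (hL.isPreconnected_leg x).intermediate_value (hL.top_mem_leg x) (hL.self_mem_leg x)
      hc.continuousOn ⟨by rw [h0]; linarith [hnn x], by linarith [hnn x]⟩
  choose f hf hfh using hex
  refine ⟨f, ?_, ?_, hf, ?_⟩
  · refine continuous_iff_isClosed.2 fun A hA => ?_
    have : f ⁻¹' A = Prod.fst '' ({q : L × L | q.2 ∈ leg v q.1} ∩ {q | h q.2 = h q.1 / 2} ∩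
        {q | q.2 ∈ A}) := by
      ext x
      constructor
      · exact fun hx => ⟨(x, f x), ⟨⟨hf x, hfh x⟩, hx⟩, rfl⟩
      · rintro ⟨⟨x', y⟩, ⟨⟨h1, h2⟩, h3⟩, rfl⟩
        have : f x' = y := huniq _ _ (hL.leg_total (hf x') h1) ((hfh x').trans h2.symm)
        exact mem_preimage.2 (this.symm ▸ h3)
    rw [this]
    refine isClosedMap_fst_of_compactSpace _ (((hL.isClosed_mem_leg.preimage
      continuous_swap).inter (isClosed_eq ?_ ?_)).inter (hA.preimage continuous_snd))
    · fun_prop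
    · fun_prop
  · intro x y hxy
    have he : h x = h y := by
      have h1 := hfh x
      have h2 := hfh y
      rw [hxy] at h1
      linarith
    by_cases hv : f x = v
    · have hz : ∀ z, f z = v → z = v := fun z hz => by
        by_contra hne
        have h1 := hfh z
        rw [hz, h0] at h1
        linarith [hpos z hne]
      rw [hz x hv, hz y (hxy ▸ hv)]
    · exact huniq x y (hL.mem_leg_or_mem_leg hv (hf x) (hxy ▸ hf y)) he
  · intro x hx
    refine ⟨fun hv => ?_, fun hm => ?_⟩
    · have h1 := hfh x
      rw [hv, h0] at h1
      linarith [hpos x hx]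
    · linarith [hle _ _ hm, hfh x, hpos x hx]

end IsSmoothFan

end SmoothFan

section CantorFan

/-- The point at height `t` on the leg of the Cantor fan through `z`, with `t` clamped to
`[0, 1]`. -/
noncomputable def cantorLeg (z : ℕ → Bool) (t : ℝ) : CantorFanSpace :=
  Quotient.mk _ (z, projIcc 0 1 zero_le_one t)

lemma continuous_cantorLeg (z : ℕ → Bool) : Continuous (cantorLeg z) :=
  continuous_quotient_mk'.comp (continuous_const.prodMk continuous_projIcc)

lemma exists_cantorLeg_eq (p : CantorFanSpace) :
    ∃ z, ∃ t ∈ Icc (0 : ℝ) 1, cantorLeg z t = p := by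
  obtain ⟨⟨z, t⟩, rfl⟩ := Quotient.exists_rep p
  exact ⟨z, t, t.2, by rw [cantorLeg, projIcc_val]⟩

lemma cantorLeg_zero (z z' : ℕ → Bool) : cantorLeg z 0 = cantorLeg z' 0 :=
  Quotient.sound (Or.inr ⟨by simp, by simp⟩)

lemma cantorLeg_eq {z z' : ℕ → Bool} {s t : ℝ} (hs : s ∈ Icc (0 : ℝ) 1) (ht : t ∈ Icc (0 : ℝ) 1)
    (h : cantorLeg z s = cantorLeg z' t) : s = t ∧ (z = z' ∨ s = 0) := by
  have h' := Quotient.exact h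
  simp only [projIcc_of_mem zero_le_one hs, projIcc_of_mem zero_le_one ht] at h'
  rcases h' with h' | ⟨h1, h2⟩
  · simp only [Prod.mk.injEq, Subtype.mk.injEq] at h'
    exact ⟨h'.2, Or.inl h'.1⟩
  · exact ⟨h1.trans h2.symm, Or.inr h1⟩

lemma injOn_cantorLeg (z : ℕ → Bool) : InjOn (cantorLeg z) (Icc 0 1) :=
  fun _ hs _ ht h => (cantorLeg_eq hs ht h).1

/-- The map of the Cantor fan that doubles heights, clamping them to `[0, 1]`. -/
noncomputable def cantorDouble : CantorFanSpace → CantorFanSpace :=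
  Quotient.map (fun p => (p.1, projIcc 0 1 zero_le_one (2 * (p.2 : ℝ)))) (by
    rintro p q (rfl | ⟨h1, h2⟩)
    · exact Or.inl rfl
    · exact Or.inr ⟨by simp [h1], by simp [h2]⟩)

lemma continuous_cantorDouble : Continuous cantorDouble := by
  refine Continuous.quotient_map' ?_ _
  exact continuous_fst.prodMk (continuous_projIcc.comp (by fun_prop))

lemma cantorDouble_cantorLeg (z : ℕ → Bool) {t : ℝ} (ht : t ∈ Icc (0 : ℝ) 1) :
    cantorDouble (cantorLeg z t) = cantorLeg z (2 * t) := by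
  simp only [cantorDouble, cantorLeg, Quotient.map_mk, projIcc_of_mem zero_le_one ht]

lemma cantorLeg_min (z : ℕ → Bool) (t : ℝ) : cantorLeg z (min 1 t) = cantorLeg z t := by
  rcases le_total 1 t with h | h
  · rw [min_eq_left h, cantorLeg, cantorLeg, projIcc_of_right_le _ h, projIcc_right]
  · rw [min_eq_right h]

/-- Embeddings of the Cantor fan send its apex to a ramification point. -/
lemma isRamificationPoint_apex {X : Type*} [TopologicalSpace X] [T2Space X]
    {e : CantorFanSpace → X} (he : Continuous e) (hinj : Function.Injective e) (z : ℕ → Bool) :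
    IsRamificationPoint univ (e (cantorLeg z 0)) := by
  let z₀ : ℕ → Bool := fun _ => false
  let z₁ : ℕ → Bool := fun _ => true
  let z₂ : ℕ → Bool := fun n => n == 0
  have h01 : z₀ ≠ z₁ := fun h => by simpa [z₀, z₁] using congrFun h 0
  have h02 : z₀ ≠ z₂ := fun h => by simpa [z₀, z₂] using congrFun h 0
  have h12 : z₁ ≠ z₂ := fun h => by simpa [z₁, z₂] using congrFun h 1
  let γ : ℝ → CantorFanSpace := fun a => if a ≤ 0 then cantorLeg z₀ (-a) else cantorLeg z₁ a
  have hγ : Continuous γ :=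
    ((continuous_cantorLeg z₀).comp continuous_neg).if_le (continuous_cantorLeg z₁)
      continuous_id continuous_const (by
        rintro a rfl
        rw [Function.comp_apply, neg_zero]
        exact cantorLeg_zero _ _)
  have hneg : ∀ a : ℝ, a ≤ 0 → γ a = cantorLeg z₀ (-a) := fun a ha => if_pos ha
  have hpos : ∀ a : ℝ, 0 < a → γ a = cantorLeg z₁ a := fun a ha => if_neg ha.not_ge
  have := isRamificationPoint_of_paths (γ := e ∘ γ) (β := e ∘ cantorLeg z₂) (he.comp hγ)
    (he.comp (continuous_cantorLeg z₂)) (hinj.comp_injOn ?_)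
    (hinj.comp_injOn (injOn_cantorLeg z₂)) ?_ ?_
  · rw [Function.comp_apply, hneg 0 le_rfl, neg_zero, cantorLeg_zero z₀ z] at this
    exact this
  · intro a ha b hb hab
    rcases le_or_gt a 0 with ha0 | ha0 <;> rcases le_or_gt b 0 with hb0 | hb0
    · rw [hneg a ha0, hneg b hb0] at hab
      linarith [injOn_cantorLeg z₀ ⟨by linarith, by linarith [ha.1]⟩
        ⟨by linarith, by linarith [hb.1]⟩ hab]
    · rw [hneg a ha0, hpos b hb0] at hab
      obtain ⟨h1, h2 | h2⟩ := cantorLeg_eq ⟨by linarith, by linarith [ha.1]⟩ ⟨hb0.le, hb.2⟩ hab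
      · exact absurd h2 h01
      · linarith
    · rw [hpos a ha0, hneg b hb0] at hab
      obtain ⟨h1, h2 | h2⟩ := cantorLeg_eq ⟨ha0.le, ha.2⟩ ⟨by linarith, by linarith [hb.1]⟩ hab
      · exact absurd h2.symm h01
      · linarith
    · rw [hpos a ha0, hpos b hb0] at hab
      exact injOn_cantorLeg z₁ ⟨ha0.le, ha.2⟩ ⟨hb0.le, hb.2⟩ hab
  · rw [Function.comp_apply, Function.comp_apply, hneg 0 le_rfl, neg_zero, cantorLeg_zero z₀ z₂]
  · intro a ha b hb hab
    replace hab := hinj hab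
    rcases le_or_gt a 0 with ha0 | ha0
    · rw [hneg a ha0] at hab
      obtain ⟨h1, h2 | h2⟩ := cantorLeg_eq ⟨by linarith, by linarith [ha.1]⟩ hb hab
      · exact absurd h2 h02
      · rw [← h1, h2]
    · rw [hpos a ha0] at hab
      obtain ⟨h1, h2 | h2⟩ := cantorLeg_eq ⟨ha0.le, ha.2⟩ hb hab
      · exact absurd h2 h12
      · rw [← h1, h2]

/-- An embedding of a Lelek fan into itself through a Cantor fan admits no retraction. -/
lemma IsLelekFan.not_exists_retraction_of_cantorFan {L : Type*} [MetricSpace L] {v : L}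
    (hLel : IsLelekFan (univ : Set L) v) {g : L → CantorFanSpace} {e : CantorFanSpace → L}
    (hg : Continuous g) (hgi : Function.Injective g) (he : Continuous e)
    (hei : Function.Injective e) :
    ¬ ∃ r : L → L, Continuous r ∧ (∀ x, r x ∈ range (e ∘ g)) ∧ ∀ x ∈ range (e ∘ g), r x = x := by
  have hL := hLel.1
  have apex : ∀ z, e (cantorLeg z 0) = v := fun z =>
    hL.1.1.2 _ _ (isRamificationPoint_apex he hei z) hL.1.2
  have hleg : ∀ z, ∀ t ∈ Icc (0 : ℝ) 1,
      leg v (e (cantorLeg z t)) = (e ∘ cantorLeg z) '' Icc 0 t := fun z t ht =>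
    hL.leg_eq_image (γ := e ∘ cantorLeg z) ht.1 (he.comp (continuous_cantorLeg z)).continuousOn
      (hei.comp_injOn ((injOn_cantorLeg z).mono (Icc_subset_Icc_right ht.2))) (apex z)
  have hF : Continuous (e ∘ g) := he.comp hg
  have hFi : Function.Injective (e ∘ g) := hei.comp hgi
  obtain ⟨x, hx⟩ := hL.exists_ne_top
  obtain ⟨z, t, ht, hzt⟩ := exists_cantorLeg_eq (g x)
  have ht0 : t ≠ 0 := by
    rintro rfl
    refine hx (hFi ?_)
    rw [hL.apply_top hF hFi, Function.comp_apply, ← hzt, apex]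
  have htpos : 0 < t := lt_of_le_of_ne ht.1 ht0.symm
  have ht2 : t / 2 ∈ Icc (0 : ℝ) 1 := ⟨by linarith, by linarith [ht.2]⟩
  have hmem : e (cantorLeg z (t / 2)) ∈ leg v (e (g x)) := by
    rw [← hzt, hleg z t ht]
    exact ⟨t / 2, ⟨ht2.1, by linarith⟩, rfl⟩
  obtain ⟨w, -, hw⟩ := (hL.image_leg hF hFi x).symm.subset hmem
  have hgw : g w = cantorLeg z (t / 2) := hei hw
  have hEw : cantorDouble (g w) = g x := by
    rw [hgw, cantorDouble_cantorLeg z ht2, mul_div_cancel₀ t two_ne_zero, hzt]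
  refine hLel.not_exists_retraction (F := e ∘ g) (E := e ∘ cantorDouble ∘ g) (w := w) hF hFi
    (he.comp (continuous_cantorDouble.comp hg)) ?_ ?_ ⟨x, ?_⟩ ?_
  · intro y
    obtain ⟨z, s, hs, hzs⟩ := exists_cantorLeg_eq (g y)
    have hm : min 1 (2 * s) ∈ Icc (0 : ℝ) 1 :=
      ⟨le_min zero_le_one (by linarith [hs.1]), min_le_left _ _⟩
    simp only [Function.comp_apply]
    rw [← hzs, cantorDouble_cantorLeg z hs, ← cantorLeg_min, hleg z _ hm]
    exact ⟨s, ⟨hs.1, le_min hs.2 (by linarith [hs.1])⟩, rfl⟩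
  · rintro rfl
    rw [hL.apply_top hF hFi, ← apex z] at hw
    linarith [injOn_cantorLeg z ⟨le_rfl, zero_le_one⟩ ht2 (hei hw)]
  · simp only [Function.comp_apply, hEw]
  · simp only [Function.comp_apply, hEw]
    rw [← hzt, hgw, hleg z _ ht2]
    rintro ⟨s, hs, hst⟩
    have := injOn_cantorLeg z ⟨hs.1, hs.2.trans ht2.2⟩ ht (hei hst)
    linarith [hs.2]

end CantorFan

/-- there is an embedding of the Lelek fan `L` into itself admitting
no retraction; in fact any embedding factoring through a Cantor fan `C` admits
no retraction. -/
theorem stmt9 {L C : Type*} [MetricSpace L] [MetricSpace C] (v : L) (w : C)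
    (hL : IsLelekFan (Set.univ : Set L) v) (hC : IsCantorFan (Set.univ : Set C) w) :
    (∃ f : L → L, Topology.IsEmbedding f ∧
      ¬ ∃ r : L → L, Continuous r ∧ (∀ x, r x ∈ Set.range f) ∧
          ∀ x ∈ Set.range f, r x = x) ∧
    (∀ (g : L → C) (e : C → L), Topology.IsEmbedding g → Topology.IsEmbedding e →
      ¬ ∃ r : L → L, Continuous r ∧ (∀ x, r x ∈ Set.range (e ∘ g)) ∧
          ∀ x ∈ Set.range (e ∘ g), r x = x) := by
  refine ⟨?_, fun g e hg he => ?_⟩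
  · have := hL.1.compactSpace
    obtain ⟨f, hf, hinj, hleg, hne⟩ := hL.1.exists_shrinking
    obtain ⟨x, hx⟩ := hL.1.exists_ne_top
    have hfx := (hne x hx).1
    exact ⟨f, (hf.isClosedEmbedding hinj).isEmbedding,
      hL.not_exists_retraction hf hinj continuous_id hleg hfx ⟨x, rfl⟩ (hne _ hfx).2⟩
  · obtain ⟨φ⟩ := hC.2
    let c : C ≃ₜ CantorFanSpace := (Homeomorph.Set.univ C).symm.trans φ
    have hcomp : (e ∘ c.symm) ∘ (c ∘ g) = e ∘ g := by
      ext x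
      simp
    rw [← hcomp]
    exact hL.not_exists_retraction_of_cantorFan (c.continuous.comp hg.continuous)
      (c.injective.comp hg.injective) (he.continuous.comp c.symm.continuous)
      (he.injective.comp c.symm.injective)
end
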